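/- arXiv:1912.04407 — 2 statements merged into one kernel-verified Lean document; each statement's English description precedes it below -/
import Mathlib

section
/- For (N,n) = (2,2): the sum of the generating functions X_{(0,0);(ℓ)}(q) + X_{(1,1);(1+ℓ)}(q) of pairs of charged Young diagrams equals q^{ℓ(ℓ+1)/2}/(q;q)_∞ times χ_NS(q)^2, where χ_NS(q) = (−q^{1/2}; q)_∞/(q; q)_∞; and X_{(0,1);(ℓ)}(q) = X_{(1,0);(ℓ)}(q) = q^{ℓ²/2}/(q;q)_∞ times χ_R(q)^2, where χ_R(q) = (−q; q)_∞/(q; q)_∞. -/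
/-- A Young diagram, identified with its weakly decreasing sequence of row lengths
(indexed from 0), eventually zero. -/
def IsYD (f : ℕ → ℕ) : Prop := Antitone f ∧ ∃ n, f n = 0

/-- The number of boxes of a Young diagram. -/
noncomputable def sizeYD (f : ℕ → ℕ) : ℕ := ∑ᶠ i, f i

/-- The infinite q-Pochhammer symbol `(a; q)_∞ = ∏_{n ≥ 0} (1 − a qⁿ)`. -/
noncomputable def qPochInf (a q : ℝ) : ℝ := ∏' k : ℕ, (1 - a * q ^ k)

/-- Number of boxes of colour `c` of a Young diagram with charge `σ`:
the (0-indexed) box `(i,j)` is coloured `(σ − i + j) mod n`. -/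
noncomputable def colCount (n σ : ℕ) (f : ℕ → ℕ) (c : ℕ) : ℕ :=
  {p : ℕ × ℕ | p.2 < f p.1 ∧ ((σ : ℤ) + p.2 - p.1) % n = c}.ncard

/-- `X_{(σ₁,σ₂);(ℓ)}(q)` for `(N,n) = (2,2)`: sum of `q^{(k_0+k_1)/2}` over pairs of
2-coloured Young diagrams with charges `(σ₁, σ₂)` and total colour-count difference
`k_1 − k_0 = ℓ`. -/
noncomputable def pairGF (σ1 σ2 : ℕ) (ℓ : ℤ) (q : ℝ) : ℝ :=
  ∑' Y : {Y : (ℕ → ℕ) × (ℕ → ℕ) // IsYD Y.1 ∧ IsYD Y.2 ∧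
      ((colCount 2 σ1 Y.1 1 + colCount 2 σ2 Y.2 1 : ℤ)
        - (colCount 2 σ1 Y.1 0 + colCount 2 σ2 Y.2 0 : ℤ)) = ℓ},
    q ^ (((sizeYD Y.1.1 + sizeYD Y.1.2 : ℕ) : ℝ) / 2)

/-- The Neveu-Schwarz character `χ_NS(q) = (−q^{1/2}; q)_∞/(q; q)_∞`. -/
noncomputable def chiNS (q : ℝ) : ℝ := qPochInf (-(q ^ ((1 : ℝ) / 2))) q / qPochInf q q

/-- The Ramond character `χ_R(q) = (−q; q)_∞/(q; q)_∞`. -/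
noncomputable def chiR (q : ℝ) : ℝ := qPochInf (-q) q / qPochInf q q


namespace N2aux

open Filter Topology

/-- `1/(q;q)_n`, extended by zero to negative `n`. -/
noncomputable def rr (q : ℝ) (n : ℤ) : ℝ :=
  if n < 0 then 0 else (∏ i ∈ Finset.range n.toNat, (1 - q * q ^ i))⁻¹

lemma fac_pos {q : ℝ} (h0 : 0 < q) (h1 : q < 1) (i : ℕ) : 0 < 1 - q * q ^ i := by
  rw [← pow_succ']
  have := pow_lt_one₀ h0.le h1 (Nat.succ_ne_zero i)
  simpa using this

lemma rr_pred {q : ℝ} (h0 : 0 < q) (h1 : q < 1) (n : ℤ) :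
    rr q (n - 1) = (1 - q ^ n) * rr q n := by
  rcases lt_trichotomy n 0 with h | h | h
  · rw [rr, rr, if_pos (by omega), if_pos h, mul_zero]
  · subst h; simp [rr]
  · obtain ⟨k, rfl⟩ : ∃ k : ℕ, n = k + 1 := ⟨(n - 1).toNat, by omega⟩
    rw [rr, rr, if_neg (by omega), if_neg (by omega)]
    have e1 : ((k : ℤ) + 1 - 1).toNat = k := by omega
    have e2 : ((k : ℤ) + 1).toNat = k + 1 := by omega
    rw [e1, e2, Finset.prod_range_succ, mul_inv]
    have hk := (fac_pos h0 h1 k).ne'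
    have : q ^ ((k : ℤ) + 1) = q * q ^ k := by
      rw [← pow_succ']; exact_mod_cast rfl
    rw [this]
    field_simp

lemma summable_qq {a q : ℝ} (h0 : 0 < q) (h1 : q < 1) : Summable fun i : ℕ => ‖a * q ^ i‖ := by
  have := ((summable_geometric_of_lt_one h0.le h1).mul_left a).norm
  simpa using this

lemma mult_qq {a q : ℝ} (h0 : 0 < q) (h1 : q < 1) : Multipliable fun i : ℕ => (1 - a * q ^ i) := by
  have := multipliable_one_add_of_summable (f := fun i : ℕ => -(a * q ^ i))
    (by simpa using summable_qq (a := a) h0 h1)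
  simpa [sub_eq_add_neg] using this

lemma tendsto_qq {a q : ℝ} (h0 : 0 < q) (h1 : q < 1) :
    Tendsto (fun n => ∏ i ∈ Finset.range n, (1 - a * q ^ i)) atTop (𝓝 (qPochInf a q)) :=
  (mult_qq h0 h1).tendsto_prod_tprod_nat

lemma poch_ne {q : ℝ} (h0 : 0 < q) (h1 : q < 1) : qPochInf q q ≠ 0 := by
  have := tprod_one_add_ne_zero_of_summable (f := fun i : ℕ => -(q * q ^ i))
    (fun i => by have := (fac_pos h0 h1 i).ne'; simpa [sub_eq_add_neg] using this)
    (by simpa using summable_qq (a := q) h0 h1)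
  simpa [qPochInf, sub_eq_add_neg] using this

lemma prod_anti {q : ℝ} (h0 : 0 < q) (h1 : q < 1) :
    Antitone (fun n => ∏ i ∈ Finset.range n, (1 - q * q ^ i)) := by
  refine antitone_nat_of_succ_le fun n => ?_
  rw [Finset.prod_range_succ]
  refine mul_le_of_le_one_right (Finset.prod_nonneg fun i _ => (fac_pos h0 h1 i).le) ?_
  have : 0 < q * q ^ n := by positivity
  linarith

lemma poch_pos {q : ℝ} (h0 : 0 < q) (h1 : q < 1) : 0 < qPochInf q q := by
  refine lt_of_le_of_ne ?_ (poch_ne h0 h1).symm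
  exact ge_of_tendsto' (tendsto_qq h0 h1) fun n =>
    Finset.prod_nonneg fun i _ => (fac_pos h0 h1 i).le

lemma rr_nonneg {q : ℝ} (h0 : 0 < q) (h1 : q < 1) (n : ℤ) : 0 ≤ rr q n := by
  rw [rr]; split_ifs
  · exact le_rfl
  · exact inv_nonneg.2 (Finset.prod_nonneg fun i _ => (fac_pos h0 h1 i).le)

lemma rr_le {q : ℝ} (h0 : 0 < q) (h1 : q < 1) (n : ℤ) : rr q n ≤ (qPochInf q q)⁻¹ := by
  have hp := poch_pos h0 h1
  rw [rr]; split_ifs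
  · positivity
  · exact inv_anti₀ hp ((prod_anti h0 h1).le_of_tendsto (tendsto_qq h0 h1) _)

lemma rr_tendsto {q : ℝ} (h0 : 0 < q) (h1 : q < 1) (u : ℕ → ℤ) (hu : Tendsto u atTop atTop) :
    Tendsto (fun M : ℕ => rr q (u M)) atTop (𝓝 (qPochInf q q)⁻¹) := by
  have h := ((tendsto_qq (a := q) h0 h1).inv₀ (poch_ne h0 h1))
  have h2 : Tendsto (fun M => (u M).toNat) atTop atTop := by
    refine tendsto_atTop.2 fun b => ?_
    filter_upwards [tendsto_atTop.1 hu b] with M hM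
    omega
  refine (h.comp h2).congr' ?_
  filter_upwards [tendsto_atTop.1 hu 0] with M hM
  simp [rr, not_lt.2 hM]

/-! ### Summation lemmas -/

lemma hasSum_prod_nonneg {α β : Type*} {f : α × β → ℝ} {g : α → ℝ} {c : ℝ}
    (hf : ∀ x, 0 ≤ f x) (h : ∀ a, HasSum (fun b => f (a, b)) (g a)) (hg : HasSum g c) :
    HasSum f c := by
  have hs : Summable f := (summable_prod_of_nonneg (by intro x; exact hf x)).2
    ⟨fun a => (h a).summable, by
      have : (fun a => ∑' b, f (a, b)) = g := funext fun a => (h a).tsum_eq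
      rw [this]; exact hg.summable⟩
  have := hs.hasSum.prod_fiberwise h
  rw [hg.unique this]; exact hs.hasSum

lemma hasSum_exhaust {α : Type*} {F : α → ℝ} (hF : ∀ x, 0 ≤ F x) (S : ℕ → Set α)
    (hmono : Monotone S) (hU : ∀ x, ∃ N, x ∈ S N) {h : ℕ → ℝ} {c : ℝ}
    (hs : ∀ N, HasSum ((S N).indicator F) (h N)) (hc : Tendsto h atTop (𝓝 c)) :
    HasSum F c := by
  have hev : ∀ x, ∀ᶠ N in atTop, x ∈ S N := fun x => by
    obtain ⟨N, hN⟩ := hU x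
    filter_upwards [eventually_ge_atTop N] with M hM using hmono hM hN
  have hnn : ∀ N x, 0 ≤ (S N).indicator F x := fun N x =>
    Set.indicator_nonneg (fun x _ => hF x) x
  have hsum : Summable F := by
    refine summable_of_sum_le (c := c) hF fun u => ?_
    refine ge_of_tendsto hc ?_
    have : ∀ᶠ N in atTop, ∀ x ∈ u, x ∈ S N := (Filter.eventually_all_finset u).2 fun x _ => hev x
    filter_upwards [this] with N hN
    calc ∑ x ∈ u, F x = ∑ x ∈ u, (S N).indicator F x :=
          Finset.sum_congr rfl fun x hx => (Set.indicator_of_mem (hN x hx) F).symm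
      _ ≤ h N := sum_le_hasSum u (fun x _ => hnn N x) (hs N)
  have ht : Tendsto (fun N => ∑' x, (S N).indicator F x) atTop (𝓝 (∑' x, F x)) := by
    refine tendsto_tsum_of_dominated_convergence hsum (fun x => ?_) ?_
    · refine tendsto_const_nhds.congr' ?_
      filter_upwards [hev x] with N hN
      exact (Set.indicator_of_mem hN F).symm
    · refine Eventually.of_forall fun N x => ?_
      rw [Real.norm_of_nonneg (hnn N x)]
      exact Set.indicator_le_self' (fun _ _ => hF _) x
  have : (fun N => ∑' x, (S N).indicator F x) = h := funext fun N => (hs N).tsum_eq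
  rw [this] at ht
  rw [tendsto_nhds_unique hc ht]; exact hsum.hasSum

lemma tsum_parity {t : ℤ → ℝ} (ht : Summable t) (l : ℤ) :
    Summable (fun a : ℤ => t (2 * a - l)) ∧
    (∑' a : ℤ, t (2 * a - l)) + (∑' a : ℤ, t (2 * a - (l + 1))) = ∑' d, t d := by
  have i1 : Function.Injective (fun a : ℤ => 2 * a - l) := fun a b h => by
    simp only at h; omega
  have i2 : Function.Injective (fun a : ℤ => 2 * a - (l + 1)) := fun a b h => by
    simp only at h; omega
  have s1 := ht.comp_injective i1
  have s2 := ht.comp_injective i2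
  refine ⟨s1, ?_⟩
  have hc : IsCompl (Set.range (fun a : ℤ => 2 * a - l)) (Set.range (fun a : ℤ => 2 * a - (l + 1))) := by
    refine (compl_eq_iff_isCompl (α := Set ℤ)).1 ?_
    ext x
    simp only [Set.mem_compl_iff, Set.mem_range, not_exists]
    constructor
    · intro h
      refine ⟨(x + l + 1) / 2, ?_⟩
      have := h ((x + l) / 2)
      omega
    · rintro ⟨a, rfl⟩ b h
      omega
  have := HasSum.add_isCompl hc (i1.hasSum_range_iff.2 s1.hasSum) (i2.hasSum_range_iff.2 s2.hasSum)
  exact this.tsum_eq.symm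

/-! ### A finite Jacobi triple product -/

/-- The summand of the theta series. -/
noncomputable def tt (s : ℝ) (e d : ℤ) : ℝ := s ^ (d ^ 2 + e * d)

lemma tt_summable {s : ℝ} (h0 : 0 < s) (h1 : s < 1) {e : ℤ} (he : e = 0 ∨ e = 1) :
    Summable (tt s e) := by
  have hg : Summable fun d : ℤ => s⁻¹ * s ^ d.natAbs := by
    refine Summable.mul_left _ ?_
    have := summable_geometric_of_lt_one h0.le h1
    refine Summable.of_nat_of_neg ?_ ?_ <;> simpa using this
  refine Summable.of_nonneg_of_le (fun d => (zpow_pos h0 _).le) (fun d => ?_) hg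
  have : s⁻¹ * s ^ d.natAbs = s ^ ((d.natAbs : ℤ) - 1) := by
    rw [zpow_sub₀ h0.ne', zpow_natCast, zpow_one]; field_simp
  rw [this, tt]
  refine zpow_le_zpow_right_of_le_one₀ h0 h1.le ?_
  rcases he with rfl | rfl <;> obtain ⟨k, rfl | rfl⟩ := d.eq_nat_or_neg <;>
    · simp only [Int.natAbs_neg, Int.natAbs_natCast]
      nlinarith [sq_nonneg ((k : ℤ) - 1), sq_nonneg (k : ℤ), sq_nonneg (2 * (k : ℤ) - 1)]

/-- Finite theta coefficients. -/
noncomputable def AA (s : ℝ) (e : ℤ) (N : ℕ) (m : ℤ) : ℝ :=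
  tt s e m * (rr (s ^ 2) (((N + 1) / 2 : ℕ) - m) * rr (s ^ 2) ((N / 2 : ℕ) + m))

variable {s : ℝ}

lemma sq_lt (h0 : 0 < s) (h1 : s < 1) : s ^ 2 < 1 := pow_lt_one₀ h0.le h1 two_ne_zero

lemma AA_nonneg (h0 : 0 < s) (h1 : s < 1) (e : ℤ) (N : ℕ) (m : ℤ) : 0 ≤ AA s e N m :=
  mul_nonneg (zpow_pos h0 _).le (mul_nonneg (rr_nonneg (by positivity) (sq_lt h0 h1) _)
    (rr_nonneg (by positivity) (sq_lt h0 h1) _))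

lemma AA_le (h0 : 0 < s) (h1 : s < 1) (e : ℤ) (N : ℕ) (m : ℤ) :
    AA s e N m ≤ tt s e m * ((qPochInf (s ^ 2) (s ^ 2))⁻¹ * (qPochInf (s ^ 2) (s ^ 2))⁻¹) := by
  have hq : 0 < s ^ 2 := by positivity
  have hp := poch_pos hq (sq_lt h0 h1)
  refine mul_le_mul_of_nonneg_left ?_ (zpow_pos h0 _).le
  exact mul_le_mul (rr_le hq (sq_lt h0 h1) _) (rr_le hq (sq_lt h0 h1) _)
    (rr_nonneg hq (sq_lt h0 h1) _) (by positivity)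

/-- q-Pascal, for the even-to-odd step and the odd-to-even step. -/
lemma pascal {q : ℝ} (h0 : 0 < q) (h1 : q < 1) (a b : ℤ) :
    (1 - q ^ (a + b)) * (rr q a * rr q b) =
      rr q (a - 1) * rr q b + q ^ a * (rr q a * rr q (b - 1)) := by
  rw [rr_pred h0 h1, rr_pred h0 h1, zpow_add₀ h0.ne']
  ring

lemma zpow_sq (n : ℤ) : (s ^ 2) ^ n = s ^ (2 * n) := by
  rw [zpow_mul]; norm_cast

lemma AA_odd (h0 : 0 < s) (h1 : s < 1) (e : ℤ) (M : ℕ) (m : ℤ) :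
    (1 - s ^ 2 * (s ^ 2) ^ (2 * M)) * AA s e (2 * M + 1) m =
      AA s e (2 * M) m + s ^ (2 * M + 1 + e : ℤ) * AA s e (2 * M) (m - 1) := by
  have hq : 0 < s ^ 2 := by positivity
  have P := pascal hq (sq_lt h0 h1) (M + 1 - m) (M + m)
  have e1 : (2 * M + 1 + 1) / 2 = M + 1 := by omega
  have e2 : (2 * M + 1) / 2 = M := by omega
  have e3 : (2 * M) / 2 = M := by omega
  simp only [AA, tt, e1, e2, e3]
  push_cast
  rw [show (M : ℤ) + 1 - m - 1 = M - m by ring,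
    show (M : ℤ) + 1 - m + (M + m) = (2 * M + 1 : ℕ) by push_cast; ring, zpow_natCast,
    zpow_sq] at P
  rw [← pow_succ']
  rw [show (M : ℤ) - (m - 1) = M + 1 - m by ring, show (M : ℤ) + (m - 1) = M + m - 1 by ring,
    mul_left_comm, P, mul_add, ← mul_assoc, ← mul_assoc, ← mul_assoc, ← mul_assoc (s ^ _) (s ^ _),
    ← zpow_add₀ h0.ne', ← zpow_add₀ h0.ne']
  ring_nf

lemma AA_even (h0 : 0 < s) (h1 : s < 1) (e : ℤ) (M : ℕ) (m : ℤ) :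
    (1 - s ^ 2 * (s ^ 2) ^ (2 * M + 1)) * AA s e (2 * M + 2) m =
      AA s e (2 * M + 1) m + s ^ (2 * M + 1 - e : ℤ) * AA s e (2 * M + 1) (m + 1) := by
  have hq : 0 < s ^ 2 := by positivity
  have P := pascal hq (sq_lt h0 h1) (M + 1 + m) (M + 1 - m)
  have e1 : (2 * M + 1 + 1) / 2 = M + 1 := by omega
  have e2 : (2 * M + 1) / 2 = M := by omega
  have e3 : (2 * M + 2) / 2 = M + 1 := by omega
  have e4 : (2 * M + 2 + 1) / 2 = M + 1 := by omega
  simp only [AA, tt, e1, e2, e4]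
  push_cast
  rw [show (M : ℤ) + 1 + m - 1 = M + m by ring,
    show (M : ℤ) + 1 + m + (M + 1 - m) = (2 * M + 1 + 1 : ℕ) by push_cast; ring, zpow_natCast,
    zpow_sq] at P
  rw [← pow_succ']
  rw [show (M : ℤ) + 1 - (m + 1) = M + 1 - m - 1 by ring,
    show (M : ℤ) + (m + 1) = M + 1 + m by ring,
    mul_left_comm, mul_comm (rr (s ^ 2) (M + 1 - m)) (rr (s ^ 2) (M + 1 + m)), P, mul_add,
    ← mul_assoc, ← mul_assoc, ← mul_assoc, ← mul_assoc (s ^ _) (s ^ _),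
    ← zpow_add₀ h0.ne', ← zpow_add₀ h0.ne']
  ring_nf

lemma AA_summable (h0 : 0 < s) (h1 : s < 1) {e : ℤ} (he : e = 0 ∨ e = 1) (N : ℕ) :
    Summable (AA s e N) :=
  Summable.of_nonneg_of_le (AA_nonneg h0 h1 e N) (AA_le h0 h1 e N)
    ((tt_summable h0 h1 he).mul_right _)

lemma AA_sum (h0 : 0 < s) (h1 : s < 1) {e : ℤ} (he : e = 0 ∨ e = 1) (M : ℕ) :
    (∏ i ∈ Finset.range (2 * M), (1 - s ^ 2 * (s ^ 2) ^ i)) * ∑' m, AA s e (2 * M) m =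
      (∏ i ∈ Finset.range M, (1 - -(s ^ (1 + e)) * (s ^ 2) ^ i)) *
      (∏ i ∈ Finset.range M, (1 - -(s ^ (1 - e)) * (s ^ 2) ^ i)) := by
  have S := AA_summable h0 h1 he
  induction M with
  | zero =>
    simp only [mul_zero, Finset.range_zero, Finset.prod_empty, one_mul]
    rw [tsum_eq_single 0]
    · simp [AA, tt, rr]
    · intro m hm
      rcases lt_or_gt_of_ne hm with h | h
      · simp [AA, rr, h]
      · simp [AA, rr, h]
  | succ M ih =>
    have o : (1 - s ^ 2 * (s ^ 2) ^ (2 * M)) * ∑' m, AA s e (2 * M + 1) m =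
        (1 + s ^ (2 * M + 1 + e : ℤ)) * ∑' m, AA s e (2 * M) m := by
      have sh := (Equiv.subRight (1 : ℤ)).tsum_eq (AA s e (2 * M))
      have sS : Summable fun c => AA s e (2 * M) (c - 1) :=
        (S (2 * M)).comp_injective (i := fun c : ℤ => c - 1) (sub_left_injective)
      simp only [Equiv.subRight_apply] at sh
      rw [← tsum_mul_left, tsum_congr (AA_odd h0 h1 e M),
        (S (2 * M)).tsum_add (sS.mul_left _), tsum_mul_left, sh]
      ring
    have v : (1 - s ^ 2 * (s ^ 2) ^ (2 * M + 1)) * ∑' m, AA s e (2 * M + 2) m =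
        (1 + s ^ (2 * M + 1 - e : ℤ)) * ∑' m, AA s e (2 * M + 1) m := by
      have sh := (Equiv.addRight (1 : ℤ)).tsum_eq (AA s e (2 * M + 1))
      have sS : Summable fun c => AA s e (2 * M + 1) (c + 1) :=
        (S (2 * M + 1)).comp_injective (i := fun c : ℤ => c + 1) (add_left_injective 1)
      simp only [Equiv.coe_addRight] at sh
      rw [← tsum_mul_left, tsum_congr (AA_even h0 h1 e M),
        (S (2 * M + 1)).tsum_add (sS.mul_left _), tsum_mul_left, sh]
      ring
    have z1 : s ^ (2 * M + 1 + e : ℤ) = s ^ (1 + e) * (s ^ 2) ^ M := by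
      rw [← pow_mul, ← zpow_natCast, ← zpow_add₀ h0.ne']; push_cast; ring_nf
    have z2 : s ^ (2 * M + 1 - e : ℤ) = s ^ (1 - e) * (s ^ 2) ^ M := by
      rw [← pow_mul, ← zpow_natCast, ← zpow_add₀ h0.ne']; push_cast; ring_nf
    rw [z1] at o
    rw [z2] at v
    rw [show 2 * (M + 1) = 2 * M + 2 by ring, Finset.prod_range_succ _ (2 * M + 1),
      Finset.prod_range_succ _ (2 * M), Finset.prod_range_succ _ M, Finset.prod_range_succ _ M]
    generalize (∑' m, AA s e (2 * M + 2) m) = S2 at v ⊢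
    generalize (∑' m, AA s e (2 * M + 1) m) = S1 at o v
    generalize (∑' m, AA s e (2 * M) m) = S0 at o ih
    generalize (∏ i ∈ Finset.range (2 * M), (1 - s ^ 2 * (s ^ 2) ^ i)) = P at ih ⊢
    generalize (1 - s ^ 2 * (s ^ 2) ^ (2 * M)) = a at o ⊢
    generalize (1 - s ^ 2 * (s ^ 2) ^ (2 * M + 1)) = b at v ⊢
    linear_combination P * a * v + P * (1 + s ^ (1 - e) * (s ^ 2) ^ M) * o + (1 + s ^ (1 - e) * (s ^ 2) ^ M) * (1 + s ^ (1 + e) * (s ^ 2) ^ M) * ih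

lemma theta_sum (h0 : 0 < s) (h1 : s < 1) {e : ℤ} (he : e = 0 ∨ e = 1) :
    ∑' m, tt s e m = qPochInf (s ^ 2) (s ^ 2) * (qPochInf (-(s ^ (1 + e))) (s ^ 2) *
      qPochInf (-(s ^ (1 - e))) (s ^ 2)) := by
  have hq : 0 < s ^ 2 := by positivity
  have hq1 := sq_lt h0 h1
  set R := (qPochInf (s ^ 2) (s ^ 2))⁻¹ with hR
  have two : Tendsto (fun M : ℕ => 2 * M) atTop atTop :=
    tendsto_id.const_mul_atTop' (by norm_num)
  have L : Tendsto (fun M : ℕ => ∑' m, AA s e (2 * M) m) atTop (𝓝 (∑' m, tt s e m * (R * R))) := by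
    refine tendsto_tsum_of_dominated_convergence ((tt_summable h0 h1 he).mul_right (R * R))
      (fun m => ?_) (Eventually.of_forall fun N m => ?_)
    · refine Tendsto.const_mul _ (Tendsto.mul ?_ ?_)
      · refine rr_tendsto hq hq1 (fun M : ℕ => (((2 * M + 1) / 2 : ℕ) : ℤ) - m) ?_
        refine tendsto_atTop.2 fun b => ?_
        filter_upwards [eventually_ge_atTop (b + m).toNat] with M hM
        omega
      · refine rr_tendsto hq hq1 (fun M : ℕ => ((2 * M / 2 : ℕ) : ℤ) + m) ?_
        refine tendsto_atTop.2 fun b => ?_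
        filter_upwards [eventually_ge_atTop (b - m).toNat] with M hM
        omega
    · rw [Real.norm_of_nonneg (AA_nonneg h0 h1 e _ m)]
      exact AA_le h0 h1 e _ m
  have L1 := ((tendsto_qq (a := s ^ 2) hq hq1).comp two).mul L
  have L2 := (tendsto_qq (a := -(s ^ (1 + e))) hq hq1).mul (tendsto_qq (a := -(s ^ (1 - e))) hq hq1)
  have := tendsto_nhds_unique (L1.congr fun M => AA_sum h0 h1 he M) L2
  rw [← this, tsum_mul_right, hR]
  have := poch_ne hq hq1
  field_simp

/-! ### Young diagrams with at most `N` rows -/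

/-- The generating function of diagrams with at most `N` rows and colour difference `m`. -/
noncomputable def HH (s : ℝ) (N : ℕ) (m : ℤ) : ℝ :=
  s ^ (2 * m ^ 2 - m) * (rr (s ^ 2) (((N + 1) / 2 : ℕ) - m) * rr (s ^ 2) ((N / 2 : ℕ) + m))

/-- The parity shift. -/
def cc (N : ℕ) : ℤ := if Even N then 1 else 0

lemma HH_rec (h0 : 0 < s) (h1 : s < 1) (N : ℕ) (m : ℤ) :
    (1 - (s ^ (N + 1)) ^ 2) * HH s (N + 1) m =
      HH s N m + s ^ (N + 1) * HH s N (cc N - m) := by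
  have hq : 0 < s ^ 2 := by positivity
  rcases Nat.even_or_odd' N with ⟨M, rfl | rfl⟩
  · have P := pascal hq (sq_lt h0 h1) (M + 1 - m) (M + m)
    have e1 : (2 * M + 1 + 1) / 2 = M + 1 := by omega
    have e2 : (2 * M + 1) / 2 = M := by omega
    have e3 : (2 * M) / 2 = M := by omega
    have e4 : cc (2 * M) = 1 := by simp [cc]
    simp only [HH, e1, e2, e3, e4]
    push_cast
    rw [show (M : ℤ) + 1 - m - 1 = M - m by ring,
      show (M : ℤ) + 1 - m + (M + m) = (2 * M + 1 : ℕ) by push_cast; ring, zpow_natCast,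
      zpow_sq] at P
    rw [pow_right_comm, show (M : ℤ) - (1 - m) = M + m - 1 by ring,
      show (M : ℤ) + (1 - m) = M + 1 - m by ring, mul_comm (rr (s ^ 2) (M + m - 1)),
      mul_left_comm, P, mul_add, ← zpow_natCast s (2 * M + 1), ← mul_assoc, ← mul_assoc,
      ← mul_assoc, ← mul_assoc (s ^ _) (s ^ _), ← zpow_add₀ h0.ne', ← zpow_add₀ h0.ne']
    push_cast
    ring_nf
  · have P := pascal hq (sq_lt h0 h1) (M + 1 + m) (M + 1 - m)
    have e1 : (2 * M + 1 + 1) / 2 = M + 1 := by omega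
    have e2 : (2 * M + 1) / 2 = M := by omega
    have e3 : (2 * M + 1 + 1 + 1) / 2 = M + 1 := by omega
    have e4 : cc (2 * M + 1) = 0 := by simp [cc]
    simp only [HH, e1, e2, e3, e4]
    push_cast
    rw [show (M : ℤ) + 1 + m - 1 = M + m by ring,
      show (M : ℤ) + 1 + m + (M + 1 - m) = (2 * M + 1 + 1 : ℕ) by push_cast; ring, zpow_natCast,
      zpow_sq] at P
    rw [pow_right_comm, show (M : ℤ) + 1 - (0 - m) = M + 1 + m by ring,
      show (M : ℤ) + (0 - m) = M + 1 - m - 1 by ring,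
      mul_left_comm, mul_comm (rr (s ^ 2) (M + 1 - m)) (rr (s ^ 2) (M + 1 + m)), P, mul_add,
      ← zpow_natCast s (2 * M + 1 + 1), ← mul_assoc, ← mul_assoc,
      ← mul_assoc, ← mul_assoc (s ^ _) (s ^ _), ← zpow_add₀ h0.ne', ← zpow_add₀ h0.ne']
    push_cast
    ring_nf

/-- Signed count of odd rows. -/
def dlN (N : ℕ) (f : ℕ → ℕ) : ℤ := ∑ i ∈ Finset.range N, (-1) ^ i * ((f i % 2 : ℕ) : ℤ)

/-- Size of the first `N` rows. -/
def szN (N : ℕ) (f : ℕ → ℕ) : ℕ := ∑ i ∈ Finset.range N, f i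

/-- Diagrams with at most `N` rows. -/
def EN (N : ℕ) : Set (ℕ → ℕ) := {f | IsYD f ∧ f N = 0}

lemma EN_zero {N : ℕ} {f : ℕ → ℕ} (hf : f ∈ EN N) {i : ℕ} (hi : N ≤ i) : f i = 0 := by
  have := hf.1.1 hi
  have := hf.2
  omega

/-- Add `k` columns of height `N+1`. -/
def addCol (N k : ℕ) (g : ℕ → ℕ) : ℕ → ℕ := fun i => if i ≤ N then g i + k else 0

/-- Removing the columns of height `N+1`. -/
def stepEquiv (N : ℕ) : ℕ × EN N ≃ EN (N + 1) where
  toFun x := ⟨addCol N x.1 x.2.1, by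
    refine ⟨⟨fun i j hij => ?_, N + 1, by simp [addCol]⟩, by simp [addCol]⟩
    have := x.2.2.1.1 hij
    simp only [addCol]
    split_ifs <;> omega⟩
  invFun f := ⟨f.1 N, fun i => f.1 i - f.1 N, by
    refine ⟨⟨fun i j hij => ?_, N, by simp⟩, by simp⟩
    have := f.2.1.1 hij
    simp only
    omega⟩
  left_inv x := by
    obtain ⟨k, g, hg⟩ := x
    have hN := hg.2
    refine Prod.ext ?_ (Subtype.ext ?_)
    · simp [addCol, hN]
    · funext i
      simp only [addCol, hN]
      by_cases h : i ≤ N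
      · simp [h]
      · have := EN_zero hg (not_le.1 h).le
        simp [h, this]
  right_inv f := by
    refine Subtype.ext (funext fun i => ?_)
    simp only [addCol]
    split_ifs with h
    · have := f.2.1.1 h
      omega
    · exact (EN_zero f.2 (by omega)).symm

lemma szN_addCol (N k : ℕ) {g : ℕ → ℕ} (hg : g ∈ EN N) :
    szN (N + 1) (addCol N k g) = (N + 1) * k + szN N g := by
  have : ∀ i ∈ Finset.range (N + 1), addCol N k g i = g i + k := fun i hi => by
    have := Finset.mem_range.1 hi
    simp [addCol, show i ≤ N by omega]
  rw [szN, Finset.sum_congr rfl this, Finset.sum_add_distrib, Finset.sum_range_succ, hg.2, szN]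
  simp; ring

lemma dlN_addCol_even (N k : ℕ) (hk : Even k) {g : ℕ → ℕ} (hg : g ∈ EN N) :
    dlN (N + 1) (addCol N k g) = dlN N g := by
  have : ∀ i ∈ Finset.range (N + 1), (-1 : ℤ) ^ i * ((addCol N k g i % 2 : ℕ) : ℤ)
      = (-1) ^ i * ((g i % 2 : ℕ) : ℤ) := fun i hi => by
    have := Finset.mem_range.1 hi
    have h2 : (g i + k) % 2 = g i % 2 := by
      have := Nat.even_iff.1 hk
      omega
    simp only [addCol, show i ≤ N by omega, if_true, h2]
  rw [dlN, Finset.sum_congr rfl this, Finset.sum_range_succ, hg.2, dlN]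
  simp

lemma dlN_addCol_odd (N k : ℕ) (hk : Odd k) {g : ℕ → ℕ} (hg : g ∈ EN N) :
    dlN (N + 1) (addCol N k g) = cc N - dlN N g := by
  have : ∀ i ∈ Finset.range (N + 1), (-1 : ℤ) ^ i * ((addCol N k g i % 2 : ℕ) : ℤ)
      = (-1) ^ i - (-1) ^ i * ((g i % 2 : ℕ) : ℤ) := fun i hi => by
    have := Finset.mem_range.1 hi
    have h2 : (((g i + k) % 2 : ℕ) : ℤ) = 1 - ((g i % 2 : ℕ) : ℤ) := by
      have := Nat.odd_iff.1 hk
      omega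
    simp only [addCol, show i ≤ N by omega, if_true, h2]
    ring
  rw [dlN, Finset.sum_congr rfl this, Finset.sum_sub_distrib, Finset.sum_range_succ _ N,
    Finset.sum_range_succ _ N, hg.2, dlN, ← Finset.sum_range_succ (fun i => (-1 : ℤ) ^ i) N,
    neg_one_geom_sum, cc]
  by_cases h : Even N <;> simp [h, Nat.even_add_one]

/-- The weight. -/
noncomputable def FF (s : ℝ) (N : ℕ) (m : ℤ) (f : ℕ → ℕ) : ℝ :=
  if dlN N f = m then s ^ szN N f else 0

lemma FF_nonneg (h0 : 0 < s) (N : ℕ) (m : ℤ) (f : ℕ → ℕ) : 0 ≤ FF s N m f := by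
  rw [FF]; split_ifs <;> positivity

lemma FF_hasSum (h0 : 0 < s) (h1 : s < 1) (N : ℕ) (m : ℤ) :
    HasSum (fun f : EN N => FF s N m f) (HH s N m) := by
  induction N generalizing m with
  | zero =>
    have hu : ∀ f : EN 0, f = ⟨fun _ => 0, ⟨fun _ _ _ => le_rfl, 0, rfl⟩, rfl⟩ := fun f =>
      Subtype.ext (funext fun i => EN_zero f.2 (Nat.zero_le i))
    have := hasSum_single (f := fun f : EN 0 => FF s 0 m f)
      ⟨fun _ => 0, ⟨fun _ _ _ => le_rfl, 0, rfl⟩, rfl⟩ (fun f hf => absurd (hu f) hf)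
    convert this using 1
    rcases lt_trichotomy m 0 with h | h | h
    · simp [HH, FF, dlN, rr, h, h.ne']
    · subst h; simp [HH, FF, dlN, rr, szN]
    · simp [HH, FF, dlN, rr, h, h.ne]
  | succ N ih =>
    rw [← (stepEquiv N).hasSum_iff]
    set x := s ^ (N + 1) with hx
    have hx0 : 0 < x := by positivity
    have hx1 : x < 1 := pow_lt_one₀ h0.le h1 (Nat.succ_ne_zero N)
    refine hasSum_prod_nonneg (g := fun k => x ^ k * HH s N (if Even k then m else cc N - m))
      (fun _ => FF_nonneg h0 _ _ _) (fun k => ?_) ?_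
    · refine ((ih (if Even k then m else cc N - m)).mul_left (x ^ k)).congr_fun ?_
      intro g
      have hs := szN_addCol N k g.2
      change FF s (N + 1) m (addCol N k g.1) = _
      rw [FF, FF, hs, pow_add, pow_mul, ← hx]
      rcases Nat.even_or_odd k with hk | hk
      · rw [dlN_addCol_even N k hk g.2, if_pos hk]
        simp
      · rw [dlN_addCol_odd N k hk g.2, if_neg (Nat.not_even_iff_odd.2 hk)]
        have : cc N - dlN N g = m ↔ dlN N g = cc N - m := by constructor <;> intro h <;> omega
        simp [this]
    · have hx2 : x ^ 2 < 1 := pow_lt_one₀ hx0.le hx1 two_ne_zero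
      have G := hasSum_geometric_of_lt_one (by positivity : 0 ≤ x ^ 2) hx2
      have ev : HasSum (fun j => x ^ (2 * j) * HH s N (if Even (2 * j) then m else cc N - m))
          ((1 - x ^ 2)⁻¹ * HH s N m) := by
        simpa [pow_mul] using G.mul_right (HH s N m)
      have od : HasSum (fun j => x ^ (2 * j + 1) *
          HH s N (if Even (2 * j + 1) then m else cc N - m))
          ((1 - x ^ 2)⁻¹ * (x * HH s N (cc N - m))) := by
        simpa [pow_mul, pow_succ, Nat.even_add_one, mul_assoc] using G.mul_right (x * HH s N (cc N - m))
      have T := HasSum.even_add_odd (f := fun k => x ^ k * HH s N (if Even k then m else cc N - m)) ev od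
      convert T using 1
      have R := HH_rec h0 h1 N m
      rw [← hx] at R
      rw [← mul_add, ← R, inv_mul_cancel_left₀ (by linarith : (1 - x ^ 2) ≠ 0)]

/-! ### Colour counts -/

lemma size_eq {N : ℕ} {f : ℕ → ℕ} (hf : f ∈ EN N) : sizeYD f = szN N f := by
  refine finsum_eq_sum_of_support_subset _ fun i hi => ?_
  by_contra h
  exact hi (EN_zero hf (by simpa using h))

lemma col_eq {N : ℕ} {f : ℕ → ℕ} (hf : f ∈ EN N) (σ c : ℕ) :
    colCount 2 σ f c = ∑ i ∈ Finset.range N, ∑ j ∈ Finset.range (f i),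
      if ((σ : ℤ) + j - i) % 2 = c then 1 else 0 := by
  have : {p : ℕ × ℕ | p.2 < f p.1 ∧ ((σ : ℤ) + p.2 - p.1) % (2 : ℕ) = c} =
      (((Finset.range N).sigma fun i => (Finset.range (f i)).filter
        fun j : ℕ => ((σ : ℤ) + j - i) % 2 = c).map (Equiv.sigmaEquivProd ℕ ℕ).toEmbedding :
        Finset (ℕ × ℕ)) := by
    ext ⟨i, j⟩
    simp only [Set.mem_ofPred_eq, Finset.coe_map, Set.mem_image, Finset.mem_coe, Finset.mem_sigma,
      Finset.mem_filter, Finset.mem_range, Equiv.coe_toEmbedding]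
    constructor
    · rintro ⟨h1, h2⟩
      refine ⟨⟨i, j⟩, ⟨?_, h1, by simpa using h2⟩, rfl⟩
      by_contra h
      have h3 : f i = 0 := EN_zero hf (not_lt.1 h)
      have h4 : j < f i := h1
      omega
    · rintro ⟨⟨i', j'⟩, ⟨_, h1, h2⟩, h3⟩
      simp only [Equiv.sigmaEquivProd_apply, Prod.mk.injEq] at h3
      obtain ⟨rfl, rfl⟩ := h3
      exact ⟨h1, by simpa using h2⟩
  rw [colCount, this, Set.ncard_coe_finset, Finset.card_map, Finset.card_sigma]
  simp

lemma row_diff (σ i n : ℕ) :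
    (∑ j ∈ Finset.range n, if ((σ : ℤ) + j - i) % 2 = (0 : ℕ) then (1 : ℤ) else 0) -
    (∑ j ∈ Finset.range n, if ((σ : ℤ) + j - i) % 2 = (1 : ℕ) then (1 : ℤ) else 0) =
      (-1) ^ σ * ((-1) ^ i * ((n % 2 : ℕ) : ℤ)) := by
  induction n with
  | zero => simp
  | succ n ih =>
    rw [Finset.sum_range_succ, Finset.sum_range_succ]
    have : ((if ((σ : ℤ) + n - i) % 2 = (0 : ℕ) then (1 : ℤ) else 0) -
        (if ((σ : ℤ) + n - i) % 2 = (1 : ℕ) then (1 : ℤ) else 0)) =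
        (-1) ^ σ * ((-1) ^ i * ((((n + 1) % 2 : ℕ) : ℤ) - ((n % 2 : ℕ) : ℤ))) := by
      rcases Nat.even_or_odd' σ with ⟨a, rfl | rfl⟩ <;>
      rcases Nat.even_or_odd' i with ⟨b, rfl | rfl⟩ <;>
      rcases Nat.even_or_odd' n with ⟨c, rfl | rfl⟩ <;>
      · simp only [pow_mul, pow_succ, pow_zero]
        norm_num <;> (try split_ifs) <;> omega
    linear_combination ih + this

lemma diff_eq {N : ℕ} {f : ℕ → ℕ} (hf : f ∈ EN N) (σ : ℕ) :
    (colCount 2 σ f 1 : ℤ) - colCount 2 σ f 0 = - ((-1) ^ σ * dlN N f) := by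
  rw [col_eq hf, col_eq hf]
  have : ∀ i ∈ Finset.range N, _ := fun i _ => row_diff σ i (f i)
  have := Finset.sum_congr rfl this
  rw [Finset.sum_sub_distrib, ← Finset.mul_sum] at this
  rw [dlN, ← this]
  push_cast
  ring

/-- The colour difference. -/
noncomputable def dd (σ : ℕ) (f : ℕ → ℕ) : ℤ := (colCount 2 σ f 1 : ℤ) - colCount 2 σ f 0

open Classical in
/-- The weight of a diagram with given charge and colour difference. -/
noncomputable def phi (s : ℝ) (σ : ℕ) (a : ℤ) (f : ℕ → ℕ) : ℝ :=
  if IsYD f ∧ dd σ f = a then s ^ sizeYD f else 0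

lemma phi_nonneg (h0 : 0 < s) (σ : ℕ) (a : ℤ) (f : ℕ → ℕ) : 0 ≤ phi s σ a f := by
  rw [phi]; split_ifs <;> positivity

/-- The sum over all diagrams. -/
noncomputable def KK (s : ℝ) (σ : ℕ) (a : ℤ) : ℝ :=
  s ^ (2 * a ^ 2 + (-1) ^ σ * a) *
    ((qPochInf (s ^ 2) (s ^ 2))⁻¹ * (qPochInf (s ^ 2) (s ^ 2))⁻¹)

lemma phi_hasSum (h0 : 0 < s) (h1 : s < 1) (σ : ℕ) (a : ℤ) :
    HasSum (phi s σ a) (KK s σ a) := by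
  have hq : 0 < s ^ 2 := by positivity
  have hq1 := sq_lt h0 h1
  have sg : ((-1 : ℤ) ^ σ) * (-1) ^ σ = 1 := by rw [← mul_pow]; simp
  set m : ℤ := -((-1) ^ σ * a) with hm
  have hmono : Monotone (fun N : ℕ => {f : ℕ → ℕ | IsYD f → f N = 0}) := by
    intro N M h f hf hY
    have h2 := hY.1 h
    have h3 : f N = 0 := hf hY
    omega
  have hU : ∀ f : ℕ → ℕ, ∃ N, f ∈ {f : ℕ → ℕ | IsYD f → f N = 0} := by
    intro f
    by_cases hY : IsYD f
    · obtain ⟨N, hN⟩ := hY.2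
      exact ⟨N, fun _ => hN⟩
    · exact ⟨0, fun h => absurd h hY⟩
  have hsum : ∀ N : ℕ, HasSum ({f : ℕ → ℕ | IsYD f → f N = 0}.indicator (phi s σ a)) (HH s N m) := by
    intro N
    have := (hasSum_subtype_iff_indicator (f := FF s N m) (s := EN N) (a := HH s N m)).1
      (FF_hasSum h0 h1 N m)
    convert this using 1
    funext f
    by_cases hE : f ∈ EN N
    · have hmem : f ∈ {f : ℕ → ℕ | IsYD f → f N = 0} := fun _ => hE.2
      rw [Set.indicator_of_mem hmem, Set.indicator_of_mem hE, phi, FF, dd, diff_eq hE, size_eq hE]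
      have : (IsYD f ∧ -((-1) ^ σ * dlN N f) = a) ↔ dlN N f = m := by
        constructor
        · rintro ⟨_, h⟩
          rw [hm, ← h]
          linear_combination -(dlN N f) * sg
        · intro h
          refine ⟨hE.1, ?_⟩
          rw [h, hm]
          linear_combination a * sg
      simp only [this]
    · rw [Set.indicator_of_notMem hE]
      by_cases hY : IsYD f
      · rw [Set.indicator_of_notMem]
        exact fun h => hE ⟨hY, h hY⟩
      · rw [Set.indicator_apply_eq_zero]
        intro _
        simp [phi, hY]
  have hlim : Tendsto (fun N => HH s N m) atTop (𝓝 (KK s σ a)) := by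
    have e : s ^ (2 * a ^ 2 + (-1) ^ σ * a) = s ^ (2 * m ^ 2 - m) := by
      congr 1
      rw [hm]
      linear_combination -2 * a ^ 2 * sg
    rw [KK, e]
    refine Tendsto.const_mul _ (Tendsto.mul ?_ ?_)
    · refine rr_tendsto hq hq1 (fun M : ℕ => (((M + 1) / 2 : ℕ) : ℤ) - m) ?_
      refine tendsto_atTop.2 fun b => ?_
      filter_upwards [eventually_ge_atTop (2 * (b + m)).toNat] with M hM
      omega
    · refine rr_tendsto hq hq1 (fun M : ℕ => ((M / 2 : ℕ) : ℤ) + m) ?_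
      refine tendsto_atTop.2 fun b => ?_
      filter_upwards [eventually_ge_atTop (2 * (b - m) + 1).toNat] with M hM
      omega
  exact hasSum_exhaust (phi_nonneg h0 σ a) _ hmono hU hsum hlim

lemma pair_eq (h0 : 0 < s) (h1 : s < 1) (σ1 σ2 : ℕ) (l : ℤ) {c : ℝ}
    (hc : HasSum (fun a => KK s σ1 a * KK s σ2 (l - a)) c) : pairGF σ1 σ2 l (s ^ 2) = c := by
  have big : HasSum (fun x : ℤ × ((ℕ → ℕ) × (ℕ → ℕ)) =>
      phi s σ1 x.1 x.2.1 * phi s σ2 (l - x.1) x.2.2) c := by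
    refine hasSum_prod_nonneg (fun x => mul_nonneg (phi_nonneg h0 _ _ _) (phi_nonneg h0 _ _ _))
      (fun a => ?_) hc
    refine hasSum_prod_nonneg (g := fun f => phi s σ1 a f * KK s σ2 (l - a))
      (fun x => mul_nonneg (phi_nonneg h0 _ _ _) (phi_nonneg h0 _ _ _)) (fun f => ?_) ?_
    · exact (phi_hasSum h0 h1 σ2 (l - a)).mul_left _
    · exact (phi_hasSum h0 h1 σ1 a).mul_right _
  have sw := (Equiv.prodComm _ _).hasSum_iff.2 big
  have fib := sw.prod_fiberwise (g := fun Y : (ℕ → ℕ) × (ℕ → ℕ) =>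
    phi s σ1 (dd σ1 Y.1) Y.1 * phi s σ2 (l - dd σ1 Y.1) Y.2) (fun Y => by
      refine hasSum_single (dd σ1 Y.1) fun a ha => ?_
      simp [phi, ha.symm])
  rw [pairGF]
  refine HasSum.tsum_eq ?_
  have key := (hasSum_subtype_iff_indicator (f := fun Y : (ℕ → ℕ) × (ℕ → ℕ) =>
    (s ^ 2) ^ (((sizeYD Y.1 + sizeYD Y.2 : ℕ) : ℝ) / 2)) (s := {Y | IsYD Y.1 ∧ IsYD Y.2 ∧
      ((colCount 2 σ1 Y.1 1 + colCount 2 σ2 Y.2 1 : ℤ)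
        - (colCount 2 σ1 Y.1 0 + colCount 2 σ2 Y.2 0 : ℤ)) = l}) (a := c)).2
  refine key ?_
  convert fib using 1
  funext Y
  have hp : (s ^ 2) ^ (((sizeYD Y.1 + sizeYD Y.2 : ℕ) : ℝ) / 2) =
      s ^ sizeYD Y.1 * s ^ sizeYD Y.2 := by
    rw [← pow_add, ← Real.rpow_natCast s 2, ← Real.rpow_mul h0.le, ← Real.rpow_natCast]
    congr 1
    push_cast
    ring
  by_cases h : IsYD Y.1 ∧ IsYD Y.2 ∧ ((colCount 2 σ1 Y.1 1 + colCount 2 σ2 Y.2 1 : ℤ)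
        - (colCount 2 σ1 Y.1 0 + colCount 2 σ2 Y.2 0 : ℤ)) = l
  · rw [Set.indicator_of_mem (by exact h), hp, phi, phi, if_pos ⟨h.1, rfl⟩, if_pos]
    refine ⟨h.2.1, ?_⟩
    rw [← h.2.2, dd, dd]; ring
  · rw [Set.indicator_of_notMem (by exact h)]
    symm
    by_cases hY : IsYD Y.1
    · rw [mul_eq_zero]
      right
      rw [phi, if_neg]
      rintro ⟨h2, h3⟩
      refine h ⟨hY, h2, ?_⟩
      rw [dd, dd] at h3
      linear_combination h3
    · simp [phi, hY]

lemma neg_one_poch {q : ℝ} (h0 : 0 < q) (h1 : q < 1) :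
    qPochInf (-1) q = 2 * qPochInf (-q) q := by
  have a := (tendsto_add_atTop_iff_nat 1).2 (tendsto_qq (a := -1) h0 h1)
  have b := (tendsto_qq (a := -q) h0 h1).const_mul 2
  refine tendsto_nhds_unique a (b.congr fun n => ?_)
  rw [Finset.prod_range_succ']
  simp only [pow_succ']
  norm_num [mul_comm]

lemma main_s (h0 : 0 < s) (h1 : s < 1) (l : ℤ) :
    (pairGF 0 0 l (s ^ 2) + pairGF 1 1 (1 + l) (s ^ 2) =
      s ^ (l * (l + 1)) / qPochInf (s ^ 2) (s ^ 2) *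
        (qPochInf (-s) (s ^ 2) / qPochInf (s ^ 2) (s ^ 2)) ^ 2) ∧
    (pairGF 0 1 l (s ^ 2) = s ^ (l ^ 2) / qPochInf (s ^ 2) (s ^ 2) *
        (qPochInf (-(s ^ 2)) (s ^ 2) / qPochInf (s ^ 2) (s ^ 2)) ^ 2) ∧
    (pairGF 1 0 l (s ^ 2) = s ^ (l ^ 2) / qPochInf (s ^ 2) (s ^ 2) *
        (qPochInf (-(s ^ 2)) (s ^ 2) / qPochInf (s ^ 2) (s ^ 2)) ^ 2) := by
  have hq : 0 < s ^ 2 := by positivity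
  have hq1 := sq_lt h0 h1
  have hp := poch_ne hq hq1
  set R := (qPochInf (s ^ 2) (s ^ 2))⁻¹ with hR
  have T0 := tt_summable h0 h1 (e := 0) (Or.inl rfl)
  have T1 := tt_summable h0 h1 (e := 1) (Or.inr rfl)
  have E0 := theta_sum h0 h1 (e := 0) (Or.inl rfl)
  have E1 := theta_sum h0 h1 (e := 1) (Or.inr rfl)
  have one : ∀ (σ1 σ2 : ℕ) (k b : ℤ) (e : ℤ) (g : ℤ → ℤ), Summable (fun a => tt s e (g a)) →
      (∀ a, 2 * a ^ 2 + (-1) ^ σ1 * a + (2 * (k - a) ^ 2 + (-1) ^ σ2 * (k - a)) =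
        b + ((g a) ^ 2 + e * g a)) →
      pairGF σ1 σ2 k (s ^ 2) = s ^ b * (R * R * (R * R)) * ∑' a, tt s e (g a) := by
    intro σ1 σ2 k b e g hs hg
    refine pair_eq h0 h1 σ1 σ2 k ?_
    refine (hs.hasSum.mul_left (s ^ b * (R * R * (R * R)))).congr_fun fun a => ?_
    have := congrArg (fun n : ℤ => s ^ n) (hg a)
    simp only [zpow_add₀ h0.ne' (2 * a ^ 2 + (-1) ^ σ1 * a), zpow_add₀ h0.ne' b] at this
    rw [KK, KK, tt]
    linear_combination (R * R * (R * R)) * this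
  have P0 := tsum_parity T0 l
  have P0' := tsum_parity T0 (l + 1)
  have P1 := tsum_parity T1 l
  have P1' := tsum_parity T1 (l + 1)
  have sym : ∑' a, tt s 1 (2 * a - (l + 1)) = ∑' a, tt s 1 (2 * a - l) := by
    rw [← (Equiv.subLeft l).tsum_eq]
    refine tsum_congr fun a => ?_
    simp only [Equiv.subLeft_apply, tt]
    congr 1
    ring
  have half : ∑' a, tt s 1 (2 * a - l) =
      qPochInf (s ^ 2) (s ^ 2) * (qPochInf (-(s ^ 2)) (s ^ 2)) ^ 2 := by
    have := P1.2
    rw [sym, E1] at this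
    norm_num at this
    rw [neg_one_poch hq hq1] at this
    linear_combination this / 2
  refine ⟨?_, ?_, ?_⟩
  · rw [one 0 0 l (l * (l + 1)) 0 (fun a => 2 * a - l) P0.1 (fun a => by ring),
      one 1 1 (1 + l) (l * (l + 1)) 0 (fun a => 2 * a - (l + 1)) P0'.1 (fun a => by ring),
      ← mul_add, P0.2, E0, hR]
    norm_num
    field_simp
  · rw [one 0 1 l (l ^ 2) 1 (fun a => 2 * a - l) P1.1 (fun a => by ring), half, hR]
    field_simp
  · have shl : ∑' a, tt s 1 (2 * (l - a) - l) = ∑' a, tt s 1 (2 * a - l) :=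
      (Equiv.subLeft l).tsum_eq (fun a => tt s 1 (2 * a - l))
    rw [one 1 0 l (l ^ 2) 1 (fun a => 2 * (l - a) - l)
      (P1.1.comp_injective (Equiv.subLeft l).injective) (fun a => by ring), shl, half, hR]
    field_simp

end N2aux

/-- `(N,n) = (2,2)` generating functions:
`X_{(0,0);(ℓ)} + X_{(1,1);(1+ℓ)} = q^{ℓ(ℓ+1)/2}/(q;q)_∞ · χ_NS(q)²` and
`X_{(0,1);(ℓ)} = X_{(1,0);(ℓ)} = q^{ℓ²/2}/(q;q)_∞ · χ_R(q)²`. -/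
theorem N2_n2_generating_functions (ℓ : ℤ) (q : ℝ) (h0 : 0 < q) (h1 : q < 1) :
    pairGF 0 0 ℓ q + pairGF 1 1 (1 + ℓ) q =
      q ^ (((ℓ * (ℓ + 1) : ℤ) : ℝ) / 2) / qPochInf q q * (chiNS q) ^ 2 ∧
    pairGF 0 1 ℓ q = pairGF 1 0 ℓ q ∧
    pairGF 0 1 ℓ q =
      q ^ (((ℓ ^ 2 : ℤ) : ℝ) / 2) / qPochInf q q * (chiR q) ^ 2 := by
  obtain ⟨s, hs, rfl⟩ : ∃ s : ℝ, 0 < s ∧ q = s ^ 2 :=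
    ⟨Real.sqrt q, Real.sqrt_pos.2 h0, (Real.sq_sqrt h0.le).symm⟩
  have hs1 : s < 1 := by nlinarith
  have hp : ∀ n : ℤ, (s ^ 2 : ℝ) ^ ((n : ℝ) / 2) = s ^ n := by
    intro n
    rw [← Real.rpow_natCast s 2, ← Real.rpow_mul hs.le, ← Real.rpow_intCast]
    congr 1
    push_cast
    ring
  have hh : (s ^ 2 : ℝ) ^ ((1 : ℝ) / 2) = s := by
    have := hp 1
    simpa using this
  obtain ⟨A, B, C⟩ := N2aux.main_s hs hs1 ℓ
  refine ⟨?_, B.trans C.symm, ?_⟩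
  · rw [A, chiNS, hh, hp]
  · rw [B, chiR, hp]
end

section
/- The level-2 string functions of affine sl(2) satisfy: c_+(q) := X^{[2,0]}_{[2,0]}(q) + X^{[2,0]}_{[0,2]}(q) = (−q^{1/2}; q)_∞/(q; q)_∞, c_−(q) := X^{[2,0]}_{[2,0]}(q) − X^{[2,0]}_{[0,2]}(q) = (q^{1/2}; q^{1/2})_∞/(q; q)_∞², and X^{[1,1]}_{[1,1]}(q) = (q²; q²)_∞/(q; q)_∞². -/
/-- The Burge-reduced generating function for `(N,n) = (2,2)`: the sum of
`q^{(|Y₁|+|Y₂|)/2}` over pairs `(Y₁, Y₂)` of 2-coloured Young diagrams with charges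
`(σ₁, σ₂)` satisfying the Burge conditions `Y_{1,i} ≥ Y_{2,i} − s₁ + 1` and
`Y_{2,i} ≥ Y_{1,i} − s₀ + 1` for all rows `i`, and with total colour-count difference
`k_1 − k_0 = ℓ`. -/
noncomputable def burgePairGF (σ1 σ2 s0 s1 : ℕ) (ℓ : ℤ) (q : ℝ) : ℝ :=
  ∑' Y : {Y : (ℕ → ℕ) × (ℕ → ℕ) // IsYD Y.1 ∧ IsYD Y.2 ∧
      (∀ i, Y.2 i + 1 ≤ Y.1 i + s1) ∧ (∀ i, Y.1 i + 1 ≤ Y.2 i + s0) ∧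
      ((colCount 2 σ1 Y.1 1 + colCount 2 σ2 Y.2 1 : ℤ)
        - (colCount 2 σ1 Y.1 0 + colCount 2 σ2 Y.2 0 : ℤ)) = ℓ},
    q ^ (((sizeYD Y.1.1 + sizeYD Y.1.2 : ℕ) : ℝ) / 2)

/-- The level-2 string function `X^{[2,0]}_{[2,0]}(q)`: `(q;q)_∞` times the
Burge-reduced generating function with charges `(0,0)`, shifts `s = [3,1]`
(`s_I = σ_I − σ_{I+1} + 1`, `s_0 = σ_2 − σ_1 + 3`), sector `δk = 0`. -/
noncomputable def X2020 (q : ℝ) : ℝ := qPochInf q q * burgePairGF 0 0 3 1 0 q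

/-- The level-2 string function `X^{[2,0]}_{[0,2]}(q)`: charges `(0,0)`, shifts
`s = [3,1]`, sector `δk = −1` (corresponding to `γ = [0,2]`). -/
noncomputable def X2002 (q : ℝ) : ℝ := qPochInf q q * burgePairGF 0 0 3 1 (-1) q

/-- The level-2 string function `X^{[1,1]}_{[1,1]}(q)`: charges `(1,0)`, shifts
`s = [2,2]`, sector `δk = 0`. -/
noncomputable def X1111 (q : ℝ) : ℝ := qPochInf q q * burgePairGF 1 0 2 2 0 q

set_option linter.unusedSimpArgs false
set_option linter.deprecated false
open Filter Topology Finset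

namespace SL2

/-! ### Pochhammer basics -/

lemma mult_poch (a q : ℝ) (h0 : 0 ≤ q) (h1 : q < 1) : Multipliable (fun k : ℕ => 1 - a * q ^ k) := by
  have hs : Summable (fun k : ℕ => -(a * q ^ k)) :=
    ((summable_geometric_of_lt_one h0 h1).mul_left a).neg
  have := Real.multipliable_one_add_of_summable hs
  simpa [sub_eq_add_neg] using this

lemma tendsto_poch (a q : ℝ) (h0 : 0 ≤ q) (h1 : q < 1) :
    Tendsto (fun n => ∏ k ∈ range n, (1 - a * q ^ k)) atTop (𝓝 (qPochInf a q)) :=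
  (mult_poch a q h0 h1).tendsto_prod_tprod_nat

noncomputable def qf (p : ℝ) (n : ℕ) : ℝ := ∏ k ∈ range n, (1 - p ^ 2 * (p ^ 2) ^ k)

variable {p : ℝ}

lemma fac_pos (h0 : 0 < p) (h1 : p < 1) (k : ℕ) : 0 < 1 - p ^ 2 * (p ^ 2) ^ k := by
  have : p ^ 2 * (p ^ 2) ^ k = p ^ (2 * k + 2) := by ring
  rw [this]
  have := pow_lt_one₀ h0.le h1 (n := 2 * k + 2) (by omega)
  linarith

lemma sq_lt (h0 : 0 < p) (h1 : p < 1) : p ^ 2 < 1 := pow_lt_one₀ h0.le h1 (by omega)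

lemma qf_pos (h0 : 0 < p) (h1 : p < 1) (n : ℕ) : 0 < qf p n :=
  Finset.prod_pos fun k _ => fac_pos h0 h1 k

lemma qf_tendsto (h0 : 0 < p) (h1 : p < 1) :
    Tendsto (qf p) atTop (𝓝 (qPochInf (p ^ 2) (p ^ 2))) :=
  tendsto_poch _ _ (by positivity) (sq_lt h0 h1)

lemma qf_anti (h0 : 0 < p) (h1 : p < 1) : Antitone (qf p) := by
  refine antitone_nat_of_succ_le fun n => ?_
  rw [qf, qf, prod_range_succ]
  have h2 : (1 - p ^ 2 * (p ^ 2) ^ n) ≤ 1 := by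
    have : 0 ≤ p ^ 2 * (p ^ 2) ^ n := by positivity
    linarith
  exact mul_le_of_le_one_right (qf_pos h0 h1 n).le h2

lemma Q_pos (h0 : 0 < p) (h1 : p < 1) : 0 < qPochInf (p ^ 2) (p ^ 2) := by
  have hge : 0 ≤ qPochInf (p ^ 2) (p ^ 2) :=
    ge_of_tendsto' (qf_tendsto h0 h1) fun n => (qf_pos h0 h1 n).le
  refine lt_of_le_of_ne hge (Ne.symm ?_)
  have hs : Summable (fun k : ℕ => ‖-(p ^ 2 * (p ^ 2) ^ k)‖) :=
    (((summable_geometric_of_lt_one (by positivity) (sq_lt h0 h1)).mul_left (p ^ 2)).neg).norm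
  have := tprod_one_add_ne_zero_of_summable (f := fun k : ℕ => -(p ^ 2 * (p ^ 2) ^ k))
    (fun k => by have := fac_pos h0 h1 k; rw [← sub_eq_add_neg]; exact this.ne') hs
  simpa [qPochInf, sub_eq_add_neg] using this

noncomputable def ee (p : ℝ) (k : ℤ) : ℝ := if k < 0 then 0 else 1 / qf p k.toNat

noncomputable def bb (p : ℝ) (j : ℤ) : ℝ := p ^ (j * j) * ee p j
noncomputable def cc (p : ℝ) (j : ℤ) : ℝ := p ^ (j * j - j) * ee p j

lemma ee_neg {k : ℤ} (h : k < 0) : ee p k = 0 := by simp [ee, h]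
lemma bb_neg {k : ℤ} (h : k < 0) : bb p k = 0 := by simp [bb, ee, h]
lemma cc_neg {k : ℤ} (h : k < 0) : cc p k = 0 := by simp [cc, ee, h]
lemma ee_nat (k : ℕ) : ee p k = 1 / qf p k := by simp [ee]

lemma ee_nonneg (h0 : 0 < p) (h1 : p < 1) (k : ℤ) : 0 ≤ ee p k := by
  unfold ee; split_ifs
  · exact le_rfl
  · exact (one_div_pos.2 (qf_pos h0 h1 _)).le

lemma ee_le (h0 : 0 < p) (h1 : p < 1) (k : ℤ) : ee p k ≤ 1 / qPochInf (p ^ 2) (p ^ 2) := by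
  unfold ee; split_ifs
  · exact (one_div_pos.2 (Q_pos h0 h1)).le
  · exact one_div_le_one_div_of_le (Q_pos h0 h1) ((qf_anti h0 h1).le_of_tendsto (qf_tendsto h0 h1) _)

lemma ee_rec (h0 : 0 < p) (h1 : p < 1) (k : ℤ) : (1 - p ^ (2 * k)) * ee p k = ee p (k - 1) := by
  rcases lt_trichotomy k 0 with h | h | h
  · rw [ee_neg h, ee_neg (by omega), mul_zero]
  · subst h; rw [ee_neg (k := 0 - 1) (by omega)]; simp
  · obtain ⟨n, rfl⟩ : ∃ n : ℕ, k = (n + 1 : ℕ) := ⟨(k - 1).toNat, by omega⟩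
    have : ((n + 1 : ℕ) : ℤ) - 1 = (n : ℕ) := by push_cast; ring
    rw [this, ee_nat, ee_nat]
    have h2 : p ^ (2 * ((n + 1 : ℕ) : ℤ)) = p ^ 2 * (p ^ 2) ^ n := by
      rw [show (2 * ((n + 1 : ℕ) : ℤ)) = ((2 * (n + 1) : ℕ) : ℤ) by push_cast; ring, zpow_natCast]
      ring
    rw [h2, qf, prod_range_succ, ← qf]
    have := fac_pos h0 h1 n
    have := qf_pos h0 h1 n
    field_simp

lemma bb_rec (h0 : 0 < p) (h1 : p < 1) (j : ℤ) :
    (1 - p ^ (2 * j)) * bb p j = p ^ (2 * j - 1) * bb p (j - 1) := by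
  unfold bb
  rw [mul_left_comm, ee_rec h0 h1, ← mul_assoc, ← zpow_add₀ h0.ne']
  congr 2; ring

lemma cc_rec (h0 : 0 < p) (h1 : p < 1) (j : ℤ) :
    (1 - p ^ (2 * j)) * cc p j = p ^ (2 * j - 2) * cc p (j - 1) := by
  unfold cc
  rw [mul_left_comm, ee_rec h0 h1, ← mul_assoc, ← zpow_add₀ h0.ne']
  congr 2; ring

lemma bb_cc (h0 : 0 < p) (j : ℤ) : bb p j = p ^ j * cc p j := by
  unfold bb cc
  rw [← mul_assoc, ← zpow_add₀ h0.ne']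
  congr 2; ring

/-- Summand identity for the first recursion. -/
lemma summand1 (h0 : 0 < p) (h1 : p < 1) (j k l : ℤ) :
    (1 - p ^ (2 * (j + k + l))) * (cc p j * ee p k * ee p l) =
      cc p (j - 1) * ee p k * ee p l
      + p ^ (j + 2 * k) * (bb p j * ee p k * ee p (l - 1))
      + p ^ (j + 2 * l) * (bb p j * ee p (k - 1) * ee p l)
      + (p ^ (2 * j) * (cc p j * ee p (k - 1) * ee p (l - 1))
        - p ^ (2 * (j - 2)) * (cc p (j - 2) * ee p k * ee p l)) := by
  have e1 := cc_rec h0 h1 j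
  have e2 := cc_rec h0 h1 (j - 1)
  rw [show j - 1 - 1 = j - 2 by ring] at e2
  have e3 : p ^ (2 * (j - 1) - 2) = p ^ (2 * (j - 2)) := by congr 1; ring
  have e4 : p ^ (2 * j - 2) = p ^ (2 * (j - 1)) := by congr 1; ring
  rw [e3] at e2
  rw [e4] at e1
  rw [← ee_rec h0 h1 k, ← ee_rec h0 h1 l, bb_cc h0 j]
  have f1 : p ^ (2 * (j + k + l)) = p ^ (2 * j) * p ^ (2 * k) * p ^ (2 * l) := by
    rw [← zpow_add₀ h0.ne', ← zpow_add₀ h0.ne']; congr 1; ring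
  have f2 : p ^ (j + 2 * k) = p ^ j * p ^ (2 * k) := zpow_add₀ h0.ne' _ _
  have f3 : p ^ (j + 2 * l) = p ^ j * p ^ (2 * l) := zpow_add₀ h0.ne' _ _
  have f4 : p ^ (2 * j) = p ^ j * p ^ j := by rw [← zpow_add₀ h0.ne']; congr 1; ring
  rw [f1, f2, f3]
  rw [f4] at e1 ⊢
  linear_combination (ee p k * ee p l) * e1 - (ee p k * ee p l) * e2

/-- Summand identity for the second recursion. -/
lemma summand2 (h0 : 0 < p) (h1 : p < 1) (j k l : ℤ) :
    (1 - p ^ (2 * (j + k + l))) * (bb p j * ee p k * ee p l) =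
      bb p j * ee p k * ee p (l - 1)
      + p ^ (j + 2 * l) * (cc p (j - 1) * ee p k * ee p l)
      + p ^ (2 * (j + 2 * l)) * (bb p j * ee p (k - 1) * ee p l)
      + (p ^ (2 * (j + l)) * (bb p j * ee p (k - 1) * ee p (l - 1))
        - p ^ (2 * (j + l - 1)) * (bb p (j - 2) * ee p k * ee p l)) := by
  have e1 := bb_rec h0 h1 j
  have e2 := bb_rec h0 h1 (j - 1)
  have e5 := bb_cc h0 (j - 1)
  rw [show j - 1 - 1 = j - 2 by ring] at e2
  rw [← ee_rec h0 h1 k, ← ee_rec h0 h1 l]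
  have f1 : p ^ (2 * (j + k + l)) = p ^ (2 * j) * p ^ (2 * k) * p ^ (2 * l) := by
    rw [← zpow_add₀ h0.ne', ← zpow_add₀ h0.ne']; congr 1; ring
  have f3 : p ^ (j + 2 * l) = p ^ (j - 1) * (p * p ^ (2 * l)) := by
    rw [← mul_assoc, ← zpow_add_one₀ h0.ne', ← zpow_add₀ h0.ne']; congr 1; ring
  have f4 : p ^ (2 * (j + 2 * l)) = p ^ (2 * j) * p ^ (2 * l) * p ^ (2 * l) := by
    rw [← zpow_add₀ h0.ne', ← zpow_add₀ h0.ne']; congr 1; ring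
  have f5 : p ^ (2 * (j + l)) = p ^ (2 * j) * p ^ (2 * l) := by
    rw [← zpow_add₀ h0.ne']; congr 1; ring
  have f6 : p ^ (2 * (j + l - 1)) = p ^ (2 * l) * p * p ^ (2 * (j - 1) - 1) := by
    rw [← zpow_add_one₀ h0.ne', ← zpow_add₀ h0.ne']; congr 1; ring
  have f7 : p ^ (2 * j - 1) = p * p ^ (2 * (j - 1)) := by
    rw [mul_comm p, ← zpow_add_one₀ h0.ne']; congr 1; ring
  rw [f7] at e1
  rw [f1, f3, f4, f5, f6]
  linear_combination (p ^ (2 * l) * ee p k * ee p l) * e1 -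
    (p ^ (2 * l) * p * ee p k * ee p l) * e2 + (p ^ (2 * l) * p * ee p k * ee p l) * e5

/-! ### The q-trinomial sums -/

noncomputable def t0 (p : ℝ) (N B k : ℤ) : ℝ := bb p (N - 2 * k + B) * ee p k * ee p (k - B)
noncomputable def t1 (p : ℝ) (N B k : ℤ) : ℝ := cc p (N - 2 * k + B) * ee p k * ee p (k - B)
noncomputable def tau0 (p : ℝ) (N B : ℤ) : ℝ := ∑' k : ℤ, t0 p N B k
noncomputable def tau1 (p : ℝ) (N B : ℤ) : ℝ := ∑' k : ℤ, t1 p N B k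

lemma summable_of_bdd (f : ℤ → ℝ) (a b : ℤ) (ha : ∀ k, k < a → f k = 0) (hb : ∀ k, b < k → f k = 0) :
    Summable f := by
  refine summable_of_finite_support ((Set.finite_Icc a b).subset fun k hk => ?_)
  by_contra h
  rw [Set.mem_Icc, not_and_or, not_le, not_le] at h
  exact hk (h.elim (ha k) (hb k))

lemma t0_summable (N B : ℤ) : Summable (t0 p N B) :=
  summable_of_bdd _ 0 (|N| + |B|) (fun k hk => by simp [t0, ee_neg hk])
    (fun k hk => by
      have h1 := le_abs_self N
      have h2 := le_abs_self B
      have h3 := abs_nonneg N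
      have h4 := abs_nonneg B
      rw [t0, bb_neg (by omega)]; simp)

lemma t1_summable (N B : ℤ) : Summable (t1 p N B) :=
  summable_of_bdd _ 0 (|N| + |B|) (fun k hk => by simp [t1, ee_neg hk])
    (fun k hk => by
      have h1 := le_abs_self N
      have h2 := le_abs_self B
      have h3 := abs_nonneg N
      have h4 := abs_nonneg B
      rw [t1, cc_neg (by omega)]; simp)

lemma hasSum_telescope (f : ℤ → ℝ) (hf : Summable f) : HasSum (fun k => f k - f (k + 1)) 0 := by
  have h1 := hf.hasSum
  have h2 : HasSum (fun k => f (k + 1)) (∑' k, f k) := by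
    exact (Equiv.addRight (1 : ℤ)).hasSum_iff.2 h1
  simpa using h1.sub h2

lemma hasSum_shift (f : ℤ → ℝ) (hf : Summable f) : HasSum (fun k => f (k - 1)) (∑' k, f k) :=
  (Equiv.subRight (1 : ℤ)).hasSum_iff.2 hf.hasSum

lemma tau1_rec (h0 : 0 < p) (h1 : p < 1) (N B : ℤ) :
    (1 - p ^ (2 * N)) * tau1 p N B =
      tau1 p (N - 1) B + p ^ (N + B) * tau0 p (N - 1) (B + 1)
        + p ^ (N - B) * tau0 p (N - 1) (B - 1) := by
  have hF : Summable (fun k : ℤ => p ^ (2 * (N - 2 * k + B)) *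
      (cc p (N - 2 * k + B) * ee p (k - 1) * ee p (k - B - 1))) := by
    refine summable_of_bdd _ 0 (|N| + |B|) (fun k hk => ?_) (fun k hk => ?_)
    · rw [ee_neg (k := k - 1) (by omega)]; simp
    · have h1 := le_abs_self N
      have h2 := le_abs_self B
      have h3 := abs_nonneg N
      have h4 := abs_nonneg B
      rw [cc_neg (by omega)]; simp
  have hL := (t1_summable (p := p) N B).hasSum.mul_left (1 - p ^ (2 * N))
  have hR := (((t1_summable (p := p) (N - 1) B).hasSum.add
    ((t0_summable (p := p) (N - 1) (B + 1)).hasSum.mul_left (p ^ (N + B)))).add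
    ((hasSum_shift _ (t0_summable (p := p) (N - 1) (B - 1))).mul_left (p ^ (N - B)))).add
    (hasSum_telescope _ hF)
  rw [add_zero] at hR
  refine hL.unique (hR.congr_fun ?_)
  intro k
  have := summand1 h0 h1 (N - 2 * k + B) k (k - B)
  unfold t0 t1
  rw [show N - 2 * k + B + k + (k - B) = N by ring, show N - 2 * k + B + 2 * k = N + B by ring,
    show N - 2 * k + B + 2 * (k - B) = N - B by ring] at this
  rw [this]
  rw [show N - 1 - 2 * k + B = N - 2 * k + B - 1 by ring,
    show N - 1 - 2 * k + (B + 1) = N - 2 * k + B by ring, show k - (B + 1) = k - B - 1 by ring,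
    show N - 1 - 2 * (k - 1) + (B - 1) = N - 2 * k + B by ring,
    show k - 1 - (B - 1) = k - B by ring, show N - 2 * (k + 1) + B = N - 2 * k + B - 2 by ring,
    show k + 1 - 1 = k by ring, show k + 1 - B - 1 = k - B by ring]

lemma tau0_rec (h0 : 0 < p) (h1 : p < 1) (N B : ℤ) :
    (1 - p ^ (2 * N)) * tau0 p N B =
      tau0 p (N - 1) (B + 1) + p ^ (N - B) * tau1 p (N - 1) B
        + p ^ (2 * (N - B)) * tau0 p (N - 1) (B - 1) := by
  have hF : Summable (fun k : ℤ => p ^ (2 * (N - k)) *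
      (bb p (N - 2 * k + B) * ee p (k - 1) * ee p (k - B - 1))) := by
    refine summable_of_bdd _ 0 (|N| + |B|) (fun k hk => ?_) (fun k hk => ?_)
    · rw [ee_neg (k := k - 1) (by omega)]; simp
    · have h1 := le_abs_self N
      have h2 := le_abs_self B
      have h3 := abs_nonneg N
      have h4 := abs_nonneg B
      rw [bb_neg (by omega)]; simp
  have hL := (t0_summable (p := p) N B).hasSum.mul_left (1 - p ^ (2 * N))
  have hR := (((t0_summable (p := p) (N - 1) (B + 1)).hasSum.add
    ((t1_summable (p := p) (N - 1) B).hasSum.mul_left (p ^ (N - B)))).add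
    ((hasSum_shift _ (t0_summable (p := p) (N - 1) (B - 1))).mul_left (p ^ (2 * (N - B))))).add
    (hasSum_telescope _ hF)
  rw [add_zero] at hR
  refine hL.unique (hR.congr_fun ?_)
  intro k
  have := summand2 h0 h1 (N - 2 * k + B) k (k - B)
  unfold t0 t1
  rw [show N - 2 * k + B + k + (k - B) = N by ring,
    show N - 2 * k + B + 2 * (k - B) = N - B by ring,
    show N - 2 * k + B + (k - B) = N - k by ring] at this
  rw [this]
  rw [show N - 1 - 2 * k + B = N - 2 * k + B - 1 by ring,
    show N - 1 - 2 * k + (B + 1) = N - 2 * k + B by ring, show k - (B + 1) = k - B - 1 by ring,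
    show N - 1 - 2 * (k - 1) + (B - 1) = N - 2 * k + B by ring,
    show k - 1 - (B - 1) = k - B by ring, show N - 2 * (k + 1) + B = N - 2 * k + B - 2 by ring,
    show k + 1 - 1 = k by ring, show k + 1 - B - 1 = k - B by ring,
    show N - (k + 1) = N - k - 1 by ring]

lemma tau0_symm (N B : ℤ) : tau0 p N (-B) = tau0 p N B := by
  unfold tau0
  rw [← (Equiv.subRight B).tsum_eq]
  refine tsum_congr fun k => ?_
  simp only [t0, Equiv.subRight_apply]
  rw [show N - 2 * (k - B) + -B = N - 2 * k + B by ring, show k - B - -B = k by ring]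
  ring

lemma tau1_symm (N B : ℤ) : tau1 p N (-B) = tau1 p N B := by
  unfold tau1
  rw [← (Equiv.subRight B).tsum_eq]
  refine tsum_congr fun k => ?_
  simp only [t1, Equiv.subRight_apply]
  rw [show N - 2 * (k - B) + -B = N - 2 * k + B by ring, show k - B - -B = k by ring]
  ring

lemma tau0_zero (B : ℤ) : tau0 p 0 B = if B = 0 then 1 else 0 := by
  unfold tau0
  rw [tsum_eq_single 0]
  · split_ifs with h
    · subst h; simp [t0, bb, ee, qf]
    · rcases lt_or_gt_of_ne h with h | h
      · rw [t0, bb_neg (by omega)]; simp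
      · rw [t0, ee_neg (k := 0 - B) (by omega)]; simp
  · intro k hk
    by_cases h : k < 0
    · rw [t0, ee_neg h]; simp
    · by_cases h' : k - B < 0
      · rw [t0, ee_neg h']; simp
      · rw [t0, bb_neg (by omega)]; simp

lemma tau1_zero (B : ℤ) : tau1 p 0 B = if B = 0 then 1 else 0 := by
  unfold tau1
  rw [tsum_eq_single 0]
  · split_ifs with h
    · subst h; simp [t1, cc, ee, qf]
    · rcases lt_or_gt_of_ne h with h | h
      · rw [t1, cc_neg (by omega)]; simp
      · rw [t1, ee_neg (k := 0 - B) (by omega)]; simp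
  · intro k hk
    by_cases h : k < 0
    · rw [t1, ee_neg h]; simp
    · by_cases h' : k - B < 0
      · rw [t1, ee_neg h']; simp
      · rw [t1, cc_neg (by omega)]; simp

/-! ### The finite path sums -/

noncomputable def Gam (p : ℝ) : ℕ → ℤ → ℤ → ℝ
  | 0, _, B => if B = 0 then 1 else 0
  | L + 1, y, B => ∑ x ∈ ({-1, 0, 1} : Finset ℤ),
      p ^ ((L + 1) * (x - y).natAbs) * Gam p L x (-B - x)

lemma qf_succ_zpow (n : ℕ) : qf p (n + 1) = qf p n * (1 - p ^ (2 * ((n : ℤ) + 1))) := by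
  rw [qf, prod_range_succ, ← qf]
  congr 2
  rw [show (2 * ((n : ℤ) + 1)) = ((2 * (n + 1) : ℕ) : ℤ) by push_cast; ring, zpow_natCast]
  ring

lemma Gam_eq (h0 : 0 < p) (h1 : p < 1) (L : ℕ) : ∀ B : ℤ,
    Gam p L 0 B = p ^ (B * B) * qf p L * tau1 p L B ∧
    Gam p L 1 B = p ^ (B * B + B) * qf p L * tau0 p L B ∧
    Gam p L (-1) B = p ^ (B * B - B) * qf p L * tau0 p L B := by
  induction L with
  | zero =>
    intro B
    simp only [Gam, Nat.cast_zero, tau0_zero, tau1_zero]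
    split_ifs with h
    · subst h; simp [qf]
    · simp
  | succ L ih =>
    intro B
    have hp := h0.ne'
    have c1 : Gam p L (-1) (-B - -1) = p ^ (B * B - B) * qf p L * tau0 p L (B - 1) := by
      rw [(ih _).2.2, show -B - -1 = -(B - 1) by ring, tau0_symm]
      congr 3; ring
    have c2 : Gam p L 0 (-B - 0) = p ^ (B * B) * qf p L * tau1 p L B := by
      rw [(ih _).1, show -B - 0 = -B by ring, tau1_symm]
      congr 3; ring
    have c3 : Gam p L 1 (-B - 1) = p ^ (B * B + B) * qf p L * tau0 p L (B + 1) := by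
      rw [(ih _).2.1, show -B - 1 = -(B + 1) by ring, tau0_symm]
      congr 3; ring
    have r1 := tau1_rec h0 h1 (L + 1) B
    have r0 := tau0_rec h0 h1 (L + 1) B
    have r0' := tau0_rec h0 h1 (L + 1) (-B)
    rw [show -B + 1 = -(B - 1) by ring, show -B - 1 = -(B + 1) by ring, tau0_symm, tau0_symm,
      tau1_symm, tau0_symm] at r0'
    rw [show ((L : ℤ) + 1 - 1) = L by ring] at r1 r0 r0'
    have z1 : p ^ (L + 1) = p ^ ((L : ℤ) + 1) := by
      rw [← zpow_natCast]; push_cast; rfl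
    have z2 : p ^ ((L + 1) * 2) = p ^ ((L : ℤ) + 1) * p ^ ((L : ℤ) + 1) := by
      rw [← z1]; ring
    have a1 : p ^ (B * B + B) = p ^ (B * B) * p ^ B := zpow_add₀ hp _ _
    have a2 : p ^ (B * B - B) = p ^ (B * B) * (p ^ B)⁻¹ := by rw [zpow_sub₀ hp]; rfl
    have a3 : p ^ ((L : ℤ) + 1 + B) = p ^ ((L : ℤ) + 1) * p ^ B := zpow_add₀ hp _ _
    have a4 : p ^ ((L : ℤ) + 1 - B) = p ^ ((L : ℤ) + 1) * (p ^ B)⁻¹ := by rw [zpow_sub₀ hp]; rfl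
    have a5 : ∀ n : ℤ, p ^ (2 * n) = p ^ n * p ^ n := fun n => by
      rw [← zpow_add₀ hp]; congr 1; ring
    have a6 : p ^ ((L : ℤ) + 1 - -B) = p ^ ((L : ℤ) + 1) * p ^ B := by rw [sub_neg_eq_add, a3]
    have hpB : p ^ B ≠ 0 := zpow_ne_zero _ hp
    rw [a5 (L + 1 - B), a4] at r0
    rw [a5 (L + 1 - -B), a6] at r0'
    rw [a3, a4] at r1
    have key : ∀ y : ℤ, Gam p (L + 1) y B =
        p ^ ((L + 1) * (-1 - y).natAbs) * Gam p L (-1) (-B - -1) +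
        (p ^ ((L + 1) * (0 - y).natAbs) * Gam p L 0 (-B - 0) +
        p ^ ((L + 1) * (1 - y).natAbs) * Gam p L 1 (-B - 1)) := by
      intro y
      rw [Gam, Finset.sum_insert (by decide), Finset.sum_insert (by decide), Finset.sum_singleton]
    rw [key, key, key, c1, c2, c3, qf_succ_zpow, a1, a2]
    push_cast
    have ib : p ^ B * (p ^ B)⁻¹ = 1 := mul_inv_cancel₀ hpB
    refine ⟨?_, ?_, ?_⟩
    · simp only [show (-1 - 0 : ℤ).natAbs = 1 by decide, show (0 - 0 : ℤ).natAbs = 0 by decide,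
        show (1 - 0 : ℤ).natAbs = 1 by decide, mul_one, mul_zero, pow_zero, z1]
      linear_combination (- p ^ (B * B) * qf p L) * r1
    · simp only [show (-1 - 1 : ℤ).natAbs = 2 by decide, show (0 - 1 : ℤ).natAbs = 1 by decide,
        show (1 - 1 : ℤ).natAbs = 0 by decide, mul_one, mul_zero, pow_zero, z1, z2]
      rw [show (p ^ (B * B) * p ^ B * (qf p L * (1 - p ^ (2 * ((L : ℤ) + 1)))) * tau0 p (L + 1) B) =
        p ^ (B * B) * p ^ B * qf p L * ((1 - p ^ (2 * ((L : ℤ) + 1))) * tau0 p (L + 1) B) by ring, r0]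
      field_simp
      ring
    · simp only [show (-1 - -1 : ℤ).natAbs = 0 by decide, show (0 - -1 : ℤ).natAbs = 1 by decide,
        show (1 - -1 : ℤ).natAbs = 2 by decide, mul_one, mul_zero, pow_zero, z1, z2]
      rw [show (p ^ (B * B) * (p ^ B)⁻¹ * (qf p L * (1 - p ^ (2 * ((L : ℤ) + 1)))) * tau0 p (L + 1) B) =
        p ^ (B * B) * (p ^ B)⁻¹ * qf p L * ((1 - p ^ (2 * ((L : ℤ) + 1))) * tau0 p (L + 1) B) by ring, r0']
      field_simp
      ring

/-! ### Euler's identity and limits -/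

lemma cc_nonneg (h0 : 0 < p) (h1 : p < 1) (j : ℤ) : 0 ≤ cc p j :=
  mul_nonneg (zpow_pos h0 _).le (ee_nonneg h0 h1 j)

lemma bb_nonneg (h0 : 0 < p) (h1 : p < 1) (j : ℤ) : 0 ≤ bb p j :=
  mul_nonneg (zpow_pos h0 _).le (ee_nonneg h0 h1 j)

lemma cc_summable (h0 : 0 < p) (h1 : p < 1) : Summable (fun j : ℕ => cc p j) := by
  have hs : Summable (fun j : ℕ => p ^ j * (p⁻¹ * (1 / qPochInf (p ^ 2) (p ^ 2)))) :=
    (summable_geometric_of_lt_one h0.le h1).mul_right _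
  refine Summable.of_nonneg_of_le (fun j => cc_nonneg h0 h1 j) (fun j => ?_) hs
  unfold cc
  rw [← mul_assoc]
  refine mul_le_mul ?_ (ee_le h0 h1 _) (ee_nonneg h0 h1 _) (by positivity)
  rw [← zpow_natCast p j, ← zpow_sub_one₀ h0.ne']
  refine zpow_le_zpow_right_of_le_one₀ h0 h1.le ?_
  nlinarith [sq_nonneg ((j : ℤ) - 1)]

noncomputable def eul (p t : ℝ) : ℝ := ∑' j : ℕ, cc p j * t ^ j

lemma eul_summable (h0 : 0 < p) (h1 : p < 1) {t : ℝ} (ht : |t| ≤ 1) :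
    Summable (fun j : ℕ => cc p j * t ^ j) := by
  refine Summable.of_norm_bounded (cc_summable h0 h1) fun j => ?_
  rw [norm_mul, Real.norm_eq_abs, abs_of_nonneg (cc_nonneg h0 h1 _), norm_pow, Real.norm_eq_abs]
  exact mul_le_of_le_one_right (cc_nonneg h0 h1 _) (pow_le_one₀ (abs_nonneg _) ht)

lemma eul_step (h0 : 0 < p) (h1 : p < 1) {t : ℝ} (ht : |t| ≤ 1) :
    eul p t = (1 + t) * eul p (p ^ 2 * t) := by
  have hq := sq_lt h0 h1
  have ht2 : |p ^ 2 * t| ≤ 1 := by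
    rw [abs_mul, abs_of_pos (by positivity)]
    exact mul_le_one₀ hq.le (abs_nonneg _) ht
  have hA := eul_summable h0 h1 ht
  have hB := eul_summable h0 h1 ht2
  have hC := hA.sub hB
  have h3 : eul p t - eul p (p ^ 2 * t) = t * eul p (p ^ 2 * t) := by
    unfold eul
    rw [← hA.tsum_sub hB, hC.tsum_eq_zero_add, ← tsum_mul_left]
    simp only [pow_zero, sub_self, zero_add]
    refine tsum_congr fun j => ?_
    have h4 := cc_rec h0 h1 ((j + 1 : ℕ) : ℤ)
    rw [show ((j + 1 : ℕ) : ℤ) - 1 = (j : ℕ) by push_cast; ring,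
      show 2 * ((j + 1 : ℕ) : ℤ) - 2 = ((2 * j : ℕ) : ℤ) by push_cast; ring,
      show 2 * ((j + 1 : ℕ) : ℤ) = ((2 * (j + 1) : ℕ) : ℤ) by push_cast; ring,
      zpow_natCast, zpow_natCast, pow_mul, pow_mul] at h4
    rw [mul_pow, mul_pow]
    linear_combination t ^ (j + 1) * h4
  linarith

lemma eul_iter (h0 : 0 < p) (h1 : p < 1) {t : ℝ} (ht : |t| ≤ 1) (n : ℕ) :
    eul p t = (∏ k ∈ range n, (1 - (-t) * (p ^ 2) ^ k)) * eul p ((p ^ 2) ^ n * t) := by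
  induction n with
  | zero => simp
  | succ n ih =>
    have ht2 : |(p ^ 2) ^ n * t| ≤ 1 := by
      rw [abs_mul, abs_of_pos (by positivity)]
      exact mul_le_one₀ (pow_le_one₀ (by positivity) (sq_lt h0 h1).le) (abs_nonneg _) ht
    rw [ih, eul_step h0 h1 ht2, prod_range_succ]
    rw [show p ^ 2 * ((p ^ 2) ^ n * t) = (p ^ 2) ^ (n + 1) * t by ring]
    ring

lemma eul_eq (h0 : 0 < p) (h1 : p < 1) {t : ℝ} (ht : |t| ≤ 1) :
    eul p t = qPochInf (-t) (p ^ 2) := by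
  have hq := sq_lt h0 h1
  have hpow : Tendsto (fun n : ℕ => (p ^ 2) ^ n * t) atTop (𝓝 0) := by
    simpa using (tendsto_pow_atTop_nhds_zero_of_lt_one (by positivity) hq).mul_const t
  have hlim : Tendsto (fun n : ℕ => eul p ((p ^ 2) ^ n * t)) atTop (𝓝 (eul p 0)) := by
    unfold eul
    refine tendsto_tsum_of_dominated_convergence (cc_summable h0 h1) (fun j => ?_) ?_
    · exact (hpow.pow j).const_mul _
    · refine Eventually.of_forall fun n j => ?_
      rw [norm_mul, Real.norm_eq_abs, abs_of_nonneg (cc_nonneg h0 h1 _), norm_pow, Real.norm_eq_abs]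
      refine mul_le_of_le_one_right (cc_nonneg h0 h1 _) (pow_le_one₀ (abs_nonneg _) ?_)
      rw [abs_mul, abs_of_pos (by positivity)]
      exact mul_le_one₀ (pow_le_one₀ (by positivity) hq.le) (abs_nonneg _) ht
  have he0 : eul p 0 = 1 := by
    unfold eul
    rw [tsum_eq_single 0 (fun j hj => by simp [hj])]
    simp [cc, ee, qf]
  rw [he0] at hlim
  have h := (tendsto_poch (-t) (p ^ 2) (by positivity) hq).mul hlim
  rw [mul_one] at h
  refine tendsto_nhds_unique (tendsto_const_nhds.congr fun n => ?_) h
  exact eul_iter h0 h1 ht n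

lemma tsum_int_eq_nat (g : ℤ → ℝ) (hg : ∀ k, k < 0 → g k = 0) : ∑' k : ℤ, g k = ∑' k : ℕ, g k := by
  refine (Function.Injective.tsum_eq (Nat.cast_injective (R := ℤ)) ?_).symm
  intro k hk
  have : 0 ≤ k := by
    by_contra h
    exact hk (hg k (by omega))
  exact ⟨k.toNat, by omega⟩

lemma summable_int_of_nat (g : ℤ → ℝ) (hg : ∀ k, k < 0 → g k = 0)
    (hs : Summable (fun k : ℕ => g k)) : Summable g := by
  refine (Function.Injective.summable_iff (Nat.cast_injective (R := ℤ)) ?_).1 hs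
  intro k hk
  refine hg k ?_
  by_contra h
  exact hk ⟨k.toNat, by omega⟩

lemma int_even_odd (g : ℤ → ℝ) (hg : ∀ k, k < 0 → g k = 0) (hs : Summable (fun k : ℕ => g k)) :
    (∑' i : ℤ, g (2 * i + 0)) + (∑' i : ℤ, g (2 * i + 1)) = ∑' j : ℕ, g j ∧
    (∑' i : ℤ, g (2 * i + 0)) - (∑' i : ℤ, g (2 * i + 1)) = ∑' j : ℕ, g j * (-1) ^ j := by
  rw [tsum_int_eq_nat (fun i => g (2 * i + 0)) (fun k hk => hg _ (by omega)),
    tsum_int_eq_nat (fun i => g (2 * i + 1)) (fun k hk => hg _ (by omega))]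
  have he : Summable (fun k : ℕ => g ((2 * k : ℕ) : ℤ)) :=
    hs.comp_injective (i := fun k : ℕ => 2 * k) (fun a b h => by simpa using h)
  have ho : Summable (fun k : ℕ => g ((2 * k + 1 : ℕ) : ℤ)) :=
    hs.comp_injective (i := fun k : ℕ => 2 * k + 1) (fun a b h => by simpa using h)
  constructor
  · rw [← tsum_even_add_odd (f := fun j : ℕ => g j) he ho]
    push_cast
    simp
  · rw [← tsum_even_add_odd (f := fun j : ℕ => g j * (-1) ^ j)]
    · simp only [pow_mul, pow_succ]
      push_cast
      simp [tsum_neg, sub_eq_add_neg]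
    · simpa [pow_mul] using he
    · simpa [pow_mul, pow_succ] using ho.neg

lemma bb_eq_nat (h0 : 0 < p) (j : ℕ) : bb p j = cc p j * p ^ j := by
  rw [bb_cc h0, zpow_natCast, mul_comm]

lemma bb_summable (h0 : 0 < p) (h1 : p < 1) : Summable (fun j : ℕ => bb p j) := by
  simp only [bb_eq_nat h0]
  exact eul_summable h0 h1 (by rw [abs_of_pos h0]; exact h1.le)

lemma bb_sums (h0 : 0 < p) (h1 : p < 1) :
    (∑' i : ℤ, bb p (2 * i + 0)) + (∑' i : ℤ, bb p (2 * i + 1)) = qPochInf (-p) (p ^ 2) ∧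
    (∑' i : ℤ, bb p (2 * i + 0)) - (∑' i : ℤ, bb p (2 * i + 1)) = qPochInf p (p ^ 2) := by
  have h := int_even_odd (bb p) (fun k hk => bb_neg hk) (bb_summable h0 h1)
  have ha : |p| ≤ 1 := by rw [abs_of_pos h0]; exact h1.le
  rw [h.1, h.2, ← eul_eq h0 h1 ha]
  refine ⟨tsum_congr fun j => bb_eq_nat h0 j, ?_⟩
  have := eul_eq h0 h1 (t := -p) (by rwa [abs_neg])
  rw [neg_neg] at this
  rw [← this]
  refine tsum_congr fun j => ?_
  rw [bb_eq_nat h0, neg_pow p j]; ring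

lemma poch_one : qPochInf 1 (p ^ 2) = 0 := by
  unfold qPochInf
  exact tprod_of_exists_eq_zero ⟨0, by simp⟩

lemma cc_sums (h0 : 0 < p) (h1 : p < 1) :
    2 * (∑' i : ℤ, cc p (2 * i + 0)) = qPochInf (-1) (p ^ 2) := by
  have h := int_even_odd (cc p) (fun k hk => cc_neg hk) (cc_summable h0 h1)
  have e1 := eul_eq h0 h1 (t := 1) (by simp)
  have e2 := eul_eq h0 h1 (t := -1) (by simp)
  rw [neg_neg, poch_one] at e2
  unfold eul at e1 e2
  simp only [one_pow, mul_one] at e1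
  linarith [h.1, h.2]

lemma ee_tendsto (h0 : 0 < p) (h1 : p < 1) (a : ℤ) :
    Tendsto (fun n : ℕ => ee p (n - a)) atTop (𝓝 (1 / qPochInf (p ^ 2) (p ^ 2))) := by
  have hk : Tendsto (fun n : ℕ => ((n : ℤ) - a).toNat) atTop atTop := by
    refine tendsto_atTop.2 fun b => ?_
    filter_upwards [eventually_ge_atTop (b + a.natAbs)] with n hn
    omega
  have h := (tendsto_const_nhds (x := (1 : ℝ))).div ((qf_tendsto h0 h1).comp hk) (Q_pos h0 h1).ne'
  refine h.congr' ?_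
  filter_upwards [eventually_ge_atTop a.natAbs] with n hn
  simp only [Function.comp, ee]
  rw [if_neg (by omega)]
  rfl

lemma lim_gen (h0 : 0 < p) (h1 : p < 1) (g : ℤ → ℝ) (B : ℤ) (hg0 : ∀ k, 0 ≤ g k)
    (hg : Summable (fun i : ℤ => g (2 * i + B))) :
    Tendsto (fun n : ℕ => qf p (2 * n) *
      ∑' k : ℤ, g (((2 * n : ℕ) : ℤ) - 2 * k + B) * ee p k * ee p (k - B)) atTop
      (𝓝 ((∑' i : ℤ, g (2 * i + B)) / qPochInf (p ^ 2) (p ^ 2))) := by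
  set Q := qPochInf (p ^ 2) (p ^ 2) with hQ
  have hQ0 := Q_pos h0 h1
  rw [← hQ] at hQ0
  have e : ∀ n : ℕ, ∑' k : ℤ, g (((2 * n : ℕ) : ℤ) - 2 * k + B) * ee p k * ee p (k - B) =
      ∑' i : ℤ, g (2 * i + B) * ee p (n - i) * ee p (n - (i + B)) := by
    intro n
    rw [← (Equiv.subLeft (n : ℤ)).tsum_eq]
    refine tsum_congr fun i => ?_
    simp only [Equiv.subLeft_apply]
    rw [show ((2 * n : ℕ) : ℤ) - 2 * (n - i) + B = 2 * i + B by push_cast; ring,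
      show (n : ℤ) - i - B = n - (i + B) by ring]
  simp only [e]
  have h2n : Tendsto (fun n : ℕ => 2 * n) atTop atTop :=
    tendsto_id.const_mul_atTop' (by norm_num)
  have hlim : Tendsto (fun n : ℕ => ∑' i : ℤ, g (2 * i + B) * ee p (n - i) * ee p (n - (i + B)))
      atTop (𝓝 (∑' i : ℤ, g (2 * i + B) * (1 / Q) * (1 / Q))) := by
    refine tendsto_tsum_of_dominated_convergence ((hg.mul_right (1 / Q)).mul_right (1 / Q))
      (fun i => ?_) ?_
    · exact ((ee_tendsto h0 h1 i).const_mul _).mul (ee_tendsto h0 h1 (i + B))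
    · refine Eventually.of_forall fun n i => ?_
      have a1 := ee_nonneg h0 h1 ((n : ℤ) - i)
      have a2 := ee_nonneg h0 h1 ((n : ℤ) - (i + B))
      have a3 := hg0 (2 * i + B)
      rw [Real.norm_eq_abs, abs_of_nonneg (by positivity)]
      have b1 := ee_le h0 h1 ((n : ℤ) - i)
      have b2 := ee_le h0 h1 ((n : ℤ) - (i + B))
      gcongr
  have h := ((qf_tendsto h0 h1).comp h2n).mul hlim
  have hv : (∑' i : ℤ, g (2 * i + B)) / Q =
      Q * ∑' i : ℤ, g (2 * i + B) * (1 / Q) * (1 / Q) := by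
    rw [tsum_mul_right, tsum_mul_right]
    field_simp
  rw [hv]
  exact h

lemma Gam_lim_0 (h0 : 0 < p) (h1 : p < 1) : Tendsto (fun n : ℕ => Gam p (2 * n) (-1) 0) atTop
    (𝓝 ((∑' i : ℤ, bb p (2 * i + 0)) / qPochInf (p ^ 2) (p ^ 2))) := by
  refine (lim_gen h0 h1 (bb p) 0 (bb_nonneg h0 h1) ?_).congr fun n => ?_
  · exact (summable_int_of_nat _ (fun k hk => bb_neg hk) (bb_summable h0 h1)).comp_injective
      (i := fun i : ℤ => 2 * i + 0) (fun a b h => by simpa using h)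
  · rw [(Gam_eq h0 h1 _ _).2.2]; simp [tau0, t0]

lemma Gam_lim_1 (h0 : 0 < p) (h1 : p < 1) : Tendsto (fun n : ℕ => Gam p (2 * n) (-1) 1) atTop
    (𝓝 ((∑' i : ℤ, bb p (2 * i + 1)) / qPochInf (p ^ 2) (p ^ 2))) := by
  refine (lim_gen h0 h1 (bb p) 1 (bb_nonneg h0 h1) ?_).congr fun n => ?_
  · exact (summable_int_of_nat _ (fun k hk => bb_neg hk) (bb_summable h0 h1)).comp_injective
      (i := fun i : ℤ => 2 * i + 1) (fun a b h => by simpa using h)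
  · rw [(Gam_eq h0 h1 _ _).2.2]; simp [tau0, t0]

lemma Gam_lim_c (h0 : 0 < p) (h1 : p < 1) : Tendsto (fun n : ℕ => Gam p (2 * n) 0 0) atTop
    (𝓝 ((∑' i : ℤ, cc p (2 * i + 0)) / qPochInf (p ^ 2) (p ^ 2))) := by
  refine (lim_gen h0 h1 (cc p) 0 (cc_nonneg h0 h1) ?_).congr fun n => ?_
  · exact (summable_int_of_nat _ (fun k hk => cc_neg hk) (cc_summable h0 h1)).comp_injective
      (i := fun i : ℤ => 2 * i + 0) (fun a b h => by simpa using h)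
  · rw [(Gam_eq h0 h1 _ _).1]; simp [tau1, t1]

/-! ### Product manipulations -/

lemma poch_split (h0 : 0 < p) (h1 : p < 1) :
    qPochInf p p = qPochInf p (p ^ 2) * qPochInf (p ^ 2) (p ^ 2) := by
  unfold qPochInf
  have hq := sq_lt h0 h1
  have e1 : ∀ k : ℕ, 1 - p * (p ^ 2) ^ k = 1 - p * p ^ (2 * k) := fun k => by rw [pow_mul]
  have e2 : ∀ k : ℕ, 1 - p ^ 2 * (p ^ 2) ^ k = 1 - p * p ^ (2 * k + 1) := fun k => by ring
  have m1 : Multipliable (fun k : ℕ => 1 - p * p ^ (2 * k)) :=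
    (mult_poch p (p ^ 2) (by positivity) hq).congr e1
  have m2 : Multipliable (fun k : ℕ => 1 - p * p ^ (2 * k + 1)) :=
    (mult_poch (p ^ 2) (p ^ 2) (by positivity) hq).congr e2
  rw [← tprod_even_mul_odd (f := fun k : ℕ => 1 - p * p ^ k) m1 m2, tprod_congr e1, tprod_congr e2]

lemma poch_double (q : ℝ) (h0 : 0 < q) (h1 : q < 1) :
    qPochInf (-1) q * qPochInf q q = 2 * qPochInf (q ^ 2) (q ^ 2) := by
  have hq2 : q ^ 2 < 1 := pow_lt_one₀ h0.le h1 (by omega)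
  have hA : qPochInf (-1) q = 2 * qPochInf (-q) q := by
    have t1 := (tendsto_poch (-1) q h0.le h1).comp (tendsto_add_atTop_nat 1)
    have t2 := (tendsto_poch (-q) q h0.le h1).const_mul 2
    refine tendsto_nhds_unique t1 (t2.congr fun n => ?_)
    simp only [Function.comp]
    rw [prod_range_succ', mul_comm]
    congr 1
    · exact prod_congr rfl fun k _ => by ring
    · norm_num
  have hB : qPochInf (-q) q * qPochInf q q = qPochInf (q ^ 2) (q ^ 2) := by
    refine tendsto_nhds_unique ((tendsto_poch (-q) q h0.le h1).mul (tendsto_poch q q h0.le h1))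
      ((tendsto_poch (q ^ 2) (q ^ 2) (by positivity) hq2).congr fun n => ?_)
    rw [← prod_mul_distrib]
    exact prod_congr rfl fun k _ => by ring
  rw [hA, ← hB]; ring

/-! ### Sums over infinite paths -/

lemma hasSum_of_exhaust {ι : Type*} (f : ι → ℝ) (hf : ∀ i, 0 ≤ f i) (S : ℕ → Finset ι)
    (hmono : Monotone S) (hex : ∀ i, f i ≠ 0 → ∃ n, i ∈ S n) (c : ℝ)
    (h : Tendsto (fun n => ∑ i ∈ S n, f i) atTop (𝓝 c)) : HasSum f c := by
  classical
  have hm : Monotone (fun n => ∑ i ∈ S n, f i) := fun a b hab =>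
    Finset.sum_le_sum_of_subset_of_nonneg (hmono hab) fun i _ _ => hf i
  have hle : ∀ n, ∑ i ∈ S n, f i ≤ c := fun n => hm.ge_of_tendsto h n
  refine hasSum_of_isLUB_of_nonneg _ hf ⟨?_, ?_⟩
  · rintro _ ⟨u, rfl⟩
    have : ∃ n, ∀ i ∈ u, f i ≠ 0 → i ∈ S n := by
      induction u using Finset.induction_on with
      | empty => exact ⟨0, by simp⟩
      | insert a u ha ih =>
        obtain ⟨n, hn⟩ := ih
        by_cases h0 : f a = 0
        · refine ⟨n, fun i hi hne => ?_⟩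
          rcases Finset.mem_insert.1 hi with rfl | hi
          · exact absurd h0 hne
          · exact hn i hi hne
        · obtain ⟨m, hm'⟩ := hex a h0
          refine ⟨max n m, fun i hi hne => ?_⟩
          rcases Finset.mem_insert.1 hi with rfl | hi
          · exact hmono (le_max_right _ _) hm'
          · exact hmono (le_max_left _ _) (hn i hi hne)
    obtain ⟨n, hn⟩ := this
    refine le_trans ?_ (hle n)
    show ∑ i ∈ u, f i ≤ _
    rw [← Finset.sum_filter_ne_zero]
    refine Finset.sum_le_sum_of_subset_of_nonneg (fun i hi => ?_) fun i _ _ => hf i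
    rw [Finset.mem_filter] at hi
    exact hn i hi.1 hi.2
  · intro b hb
    exact le_of_tendsto' h fun n => hb ⟨S n, rfl⟩

def IsPath (y : ℤ) (x : ℕ → ℤ) : Prop := (∀ i, -1 ≤ x i ∧ x i ≤ 1) ∧ ∃ N, ∀ i, N ≤ i → x i = y

noncomputable def wt (x : ℕ → ℤ) : ℕ := ∑ᶠ j : ℕ, (j + 1) * (x j - x (j + 1)).natAbs
noncomputable def stat (y : ℤ) (x : ℕ → ℤ) : ℤ := ∑ᶠ i : ℕ, (-1) ^ i * (x i - y)

lemma finsum_range {M : Type*} [AddCommMonoid M] (f : ℕ → M) (N : ℕ) (h : ∀ i, N ≤ i → f i = 0) :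
    ∑ᶠ i, f i = ∑ i ∈ range N, f i := by
  refine finsum_eq_sum_of_support_subset _ fun i hi => ?_
  by_contra hc
  exact hi (h i (by simpa using hc))

lemma wt_eq {y : ℤ} {x : ℕ → ℤ} {N : ℕ} (h : ∀ i, N ≤ i → x i = y) :
    wt x = ∑ j ∈ range N, (j + 1) * (x j - x (j + 1)).natAbs :=
  finsum_range _ N fun i hi => by rw [h i hi, h (i + 1) (by omega)]; simp

lemma stat_eq {y : ℤ} {x : ℕ → ℤ} {N : ℕ} (h : ∀ i, N ≤ i → x i = y) :
    stat y x = ∑ i ∈ range N, (-1) ^ i * (x i - y) :=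
  finsum_range _ N fun i hi => by rw [h i hi]; simp

open Classical in
noncomputable def pset : ℕ → ℤ → Finset (ℕ → ℤ)
  | 0, y => {fun _ => y}
  | L + 1, y => ({-1, 0, 1} : Finset ℤ).biUnion fun t =>
      (pset L t).image fun x i => if i ≤ L then x i else y

lemma mem_pset (L : ℕ) : ∀ (y : ℤ) (x : ℕ → ℤ), x ∈ pset L y ↔
    (∀ i, i < L → -1 ≤ x i ∧ x i ≤ 1) ∧ ∀ i, L ≤ i → x i = y := by
  induction L with
  | zero =>
    intro y x
    simp only [pset, Finset.mem_singleton]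
    constructor
    · rintro rfl; simp
    · rintro ⟨-, h⟩; funext i; exact h i (by omega)
  | succ L ih =>
    intro y x
    simp only [pset, Finset.mem_biUnion, Finset.mem_image, ih]
    constructor
    · rintro ⟨t, ht, z, ⟨hz1, hz2⟩, rfl⟩
      refine ⟨fun i hi => ?_, fun i hi => ?_⟩
      · simp only [show i ≤ L by omega, if_true]
        by_cases hiL : i < L
        · exact hz1 i hiL
        · rw [hz2 i (by omega)]
          simp only [Finset.mem_insert, Finset.mem_singleton] at ht
          omega
      · dsimp only
        rw [if_neg (by omega)]
    · rintro ⟨h1, h2⟩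
      refine ⟨x L, ?_, fun i => if i < L then x i else x L, ⟨fun i hi => ?_, fun i hi => ?_⟩, ?_⟩
      · have := h1 L (by omega)
        simp only [Finset.mem_insert, Finset.mem_singleton]
        omega
      · simp only [hi, if_true]; exact h1 i (by omega)
      · dsimp only
        rw [if_neg (by omega)]
      · funext i
        dsimp only
        by_cases hi : i ≤ L
        · rw [if_pos hi]
          by_cases hiL : i < L
          · rw [if_pos hiL]
          · rw [if_neg hiL, show i = L by omega]
        · rw [if_neg hi, h2 i (by omega)]

lemma sum_pset_succ (L : ℕ) (y : ℤ) (g : (ℕ → ℤ) → ℝ) :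
    ∑ x ∈ pset (L + 1) y, g x = ∑ t ∈ ({-1, 0, 1} : Finset ℤ), ∑ x ∈ pset L t,
      g (fun i => if i ≤ L then x i else y) := by
  classical
  rw [pset, Finset.sum_biUnion]
  · refine Finset.sum_congr rfl fun t _ => ?_
    rw [Finset.sum_image]
    intro a ha b hb hab
    rw [Finset.mem_coe, mem_pset] at ha hb
    funext i
    by_cases hi : i ≤ L
    · have := congrFun hab i
      simpa [hi] using this
    · rw [ha.2 i (by omega), hb.2 i (by omega)]
  · intro s _ t _ hst
    refine Finset.disjoint_left.2 fun x hx hx' => hst ?_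
    obtain ⟨a, ha, rfl⟩ := Finset.mem_image.1 hx
    obtain ⟨b, hb, hab⟩ := Finset.mem_image.1 hx'
    rw [mem_pset] at ha hb
    have := congrFun hab L
    simp only [le_refl, if_true] at this
    rw [← ha.2 L le_rfl, ← hb.2 L le_rfl, this]

lemma sum_pset_Gam (L : ℕ) : ∀ y B : ℤ,
    ∑ x ∈ pset L y, (if ∑ i ∈ range L, (-1) ^ (L + i) * x i = B then
      p ^ (∑ j ∈ range L, (j + 1) * (x j - x (j + 1)).natAbs) else 0) = Gam p L y B := by
  induction L with
  | zero => intro y B; simp [pset, Gam, eq_comm]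
  | succ L ih =>
    intro y B
    rw [sum_pset_succ, Gam]
    refine Finset.sum_congr rfl fun t _ => ?_
    rw [← ih, Finset.mul_sum]
    refine Finset.sum_congr rfl fun x hx => ?_
    rw [mem_pset] at hx
    have e1 : ∑ i ∈ range (L + 1), (-1) ^ (L + 1 + i) * (if i ≤ L then x i else y) =
        - (∑ i ∈ range L, (-1) ^ (L + i) * x i) - t := by
      rw [sum_range_succ, ← Finset.sum_neg_distrib]
      have hpar : (-1 : ℤ) ^ (L + 1 + L) = -1 := Odd.neg_one_pow ⟨L, by ring⟩
      rw [hpar, if_pos le_rfl, hx.2 L le_rfl, sub_eq_add_neg]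
      congr 1
      · refine Finset.sum_congr rfl fun i hi => ?_
        rw [if_pos (Finset.mem_range.1 hi).le]
        ring
      · ring
    have e2 : ∑ j ∈ range (L + 1), (j + 1) *
        ((if j ≤ L then x j else y) - (if j + 1 ≤ L then x (j + 1) else y)).natAbs =
        (∑ j ∈ range L, (j + 1) * (x j - x (j + 1)).natAbs) + (L + 1) * (t - y).natAbs := by
      rw [sum_range_succ, if_pos le_rfl, if_neg (by omega), hx.2 L le_rfl]
      congr 1
      refine Finset.sum_congr rfl fun i hi => ?_
      have := Finset.mem_range.1 hi
      rw [if_pos (by omega), if_pos (by omega)]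
    simp only [e1, e2]
    by_cases h : ∑ i ∈ range L, (-1) ^ (L + i) * x i = -B - t
    · rw [if_pos h, if_pos (by omega), pow_add, mul_comm]
    · rw [if_neg h, if_neg (by omega), mul_zero]

lemma sum_alt_even (n : ℕ) (y : ℤ) : ∑ i ∈ range (2 * n), (-1 : ℤ) ^ i * y = 0 := by
  induction n with
  | zero => simp
  | succ n ih =>
    rw [show 2 * (n + 1) = 2 * n + 1 + 1 by ring, sum_range_succ, sum_range_succ, ih, pow_succ]
    ring

open Classical in
noncomputable def pterm (p : ℝ) (y B : ℤ) (x : ℕ → ℤ) : ℝ :=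
  if IsPath y x ∧ stat y x = B then p ^ wt x else 0

lemma pterm_nonneg (h0 : 0 < p) (y B : ℤ) (x : ℕ → ℤ) : 0 ≤ pterm p y B x := by
  unfold pterm; split_ifs
  · positivity
  · exact le_rfl

lemma hasSum_path (h0 : 0 < p) (y B : ℤ) (hy : -1 ≤ y ∧ y ≤ 1) (c : ℝ)
    (h : Tendsto (fun n : ℕ => Gam p (2 * n) y B) atTop (𝓝 c)) : HasSum (pterm p y B) c := by
  refine hasSum_of_exhaust _ (pterm_nonneg h0 y B) (fun n => pset (2 * n) y) ?_ ?_ c ?_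
  · intro a b hab x hx
    simp only [mem_pset] at hx ⊢
    refine ⟨fun i hi => ?_, fun i hi => hx.2 i (by omega)⟩
    by_cases hia : i < 2 * a
    · exact hx.1 i hia
    · rw [hx.2 i (by omega)]; exact hy
  · intro x hx
    unfold pterm at hx
    split_ifs at hx with hc
    · obtain ⟨⟨h1, N, hN⟩, -⟩ := hc
      exact ⟨N, (mem_pset _ _ _).2 ⟨fun i _ => h1 i, fun i hi => hN i (by omega)⟩⟩
    · exact absurd rfl hx
  · refine h.congr fun n => ?_
    rw [← sum_pset_Gam]
    refine Finset.sum_congr rfl fun x hx => ?_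
    rw [mem_pset] at hx
    have hpath : IsPath y x := by
      refine ⟨fun i => ?_, 2 * n, hx.2⟩
      by_cases hia : i < 2 * n
      · exact hx.1 i hia
      · rw [hx.2 i (by omega)]; exact hy
    have hst : stat y x = ∑ i ∈ range (2 * n), (-1) ^ (2 * n + i) * x i := by
      rw [stat_eq hx.2]
      simp only [mul_sub, Finset.sum_sub_distrib, sum_alt_even, sub_zero]
      refine Finset.sum_congr rfl fun i _ => ?_
      rw [pow_add, pow_mul]; simp
    unfold pterm
    rw [← hst, ← wt_eq hx.2]
    simp only [hpath, true_and]

/-! ### The partition factor -/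

noncomputable def ewt (e : ℕ → ℕ) : ℕ := ∑ᶠ i : ℕ, (i + 1) * e i

open Classical in
noncomputable def eterm (p : ℝ) (e : ℕ → ℕ) : ℝ :=
  if ∃ N, ∀ i, N ≤ i → e i = 0 then p ^ (2 * ewt e) else 0

lemma eterm_nonneg (h0 : 0 < p) (e : ℕ → ℕ) : 0 ≤ eterm p e := by
  unfold eterm; split_ifs
  · positivity
  · exact le_rfl

open Classical in
noncomputable def eset (K : ℕ) : ℕ → Finset (ℕ → ℕ)
  | 0 => {fun _ => 0}
  | L + 1 => (range (K + 1) ×ˢ eset K L).image fun z i => if i = L then z.1 else z.2 i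

lemma mem_eset (K L : ℕ) : ∀ e : ℕ → ℕ, e ∈ eset K L ↔
    (∀ i, i < L → e i ≤ K) ∧ ∀ i, L ≤ i → e i = 0 := by
  induction L with
  | zero =>
    intro e
    simp only [eset, Finset.mem_singleton]
    constructor
    · rintro rfl; simp
    · rintro ⟨-, h⟩; funext i; exact h i (by omega)
  | succ L ih =>
    intro e
    simp only [eset, Finset.mem_image, Finset.mem_product, Finset.mem_range, ih, Prod.exists]
    constructor
    · rintro ⟨k, z, ⟨hk, hz1, hz2⟩, rfl⟩
      refine ⟨fun i hi => ?_, fun i hi => ?_⟩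
      · dsimp only
        split_ifs with hiL
        · omega
        · exact hz1 i (by omega)
      · dsimp only
        rw [if_neg (by omega)]; exact hz2 i (by omega)
    · rintro ⟨h1, h2⟩
      refine ⟨e L, fun i => if i < L then e i else 0, ⟨?_, fun i hi => ?_, fun i hi => ?_⟩, ?_⟩
      · have := h1 L (by omega); omega
      · simp only [hi, if_true]; exact h1 i (by omega)
      · dsimp only
        rw [if_neg (by omega)]
      · funext i
        dsimp only
        split_ifs with a b
        · rw [a]
        · rfl
        · rw [h2 i (by omega)]

lemma sum_eset (K L : ℕ) : ∑ e ∈ eset K L, p ^ (2 * ∑ i ∈ range L, (i + 1) * e i) =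
    ∏ i ∈ range L, ∑ k ∈ range (K + 1), (p ^ 2 * (p ^ 2) ^ i) ^ k := by
  classical
  induction L with
  | zero => simp [eset]
  | succ L ih =>
    rw [eset, Finset.sum_image, Finset.sum_product, prod_range_succ, ← ih, mul_comm,
      Finset.sum_mul_sum]
    · refine Finset.sum_congr rfl fun k _ => Finset.sum_congr rfl fun e _ => ?_
      dsimp only
      rw [sum_range_succ, if_pos rfl]
      have : ∑ i ∈ range L, (i + 1) * (if i = L then k else e i) = ∑ i ∈ range L, (i + 1) * e i :=
        Finset.sum_congr rfl fun i hi => by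
          rw [if_neg (Finset.mem_range.1 hi).ne]
      rw [this]
      ring
    · rintro ⟨k, e⟩ h ⟨k', e'⟩ h' heq
      simp only [Finset.coe_product, Set.mem_prod, Finset.mem_coe, mem_eset] at h h'
      have hk : k = k' := by simpa using congrFun heq L
      have he : e = e' := by
        funext i
        by_cases hi : i = L
        · rw [h.2.2 i hi.ge, h'.2.2 i hi.ge]
        · simpa [hi] using congrFun heq i
      rw [hk, he]

lemma eprod_tendsto (h0 : 0 < p) (h1 : p < 1) :
    Tendsto (fun n : ℕ => ∏ i ∈ range n, ∑ k ∈ range (n + 1), (p ^ 2 * (p ^ 2) ^ i) ^ k) atTop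
      (𝓝 (1 / qPochInf (p ^ 2) (p ^ 2))) := by
  have hq := sq_lt h0 h1
  have e : ∀ n : ℕ, ∏ i ∈ range n, ∑ k ∈ range (n + 1), (p ^ 2 * (p ^ 2) ^ i) ^ k =
      (∏ i ∈ range n, (1 - (p ^ 2 * (p ^ 2) ^ i) ^ (n + 1))) / qf p n := by
    intro n
    rw [qf, ← Finset.prod_div_distrib]
    refine Finset.prod_congr rfl fun i _ => ?_
    have := fac_pos h0 h1 i
    rw [eq_div_iff this.ne', geom_sum_mul_neg]
  simp only [e]
  refine Tendsto.div ?_ (qf_tendsto h0 h1) (Q_pos h0 h1).ne'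
  have hb : ∀ n i : ℕ, (p ^ 2 * (p ^ 2) ^ i) ^ (n + 1) ≤ (p ^ 2) ^ (n + 1) := by
    intro n i
    refine pow_le_pow_left₀ (by positivity) ?_ _
    exact mul_le_of_le_one_right (by positivity) (pow_le_one₀ (by positivity) hq.le)
  have hb1 : ∀ n : ℕ, (p ^ 2) ^ (n + 1) ≤ 1 := fun n => pow_le_one₀ (by positivity) hq.le
  have hlow : Tendsto (fun n : ℕ => 1 + (n : ℝ) * (-(p ^ 2) ^ (n + 1))) atTop (𝓝 1) := by
    have := ((tendsto_self_mul_const_pow_of_lt_one (r := p ^ 2) (by positivity) hq).mul_const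
      (p ^ 2)).const_sub 1
    simp only [zero_mul, sub_zero] at this
    refine this.congr fun n => ?_
    ring
  refine tendsto_of_tendsto_of_tendsto_of_le_of_le hlow tendsto_const_nhds (fun n => ?_) fun n => ?_
  · have hB := one_add_mul_le_pow (a := -(p ^ 2) ^ (n + 1)) (by linarith [hb1 n]) n
    refine hB.trans ?_
    have : (1 + -(p ^ 2) ^ (n + 1)) ^ n = ∏ i ∈ range n, (1 + -(p ^ 2) ^ (n + 1)) := by simp
    rw [this]
    refine Finset.prod_le_prod (fun i _ => by linarith [hb1 n]) fun i _ => by linarith [hb n i]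
  · refine Finset.prod_le_one (fun i _ => by linarith [hb1 n, hb n i]) fun i _ => ?_
    have : 0 ≤ (p ^ 2 * (p ^ 2) ^ i) ^ (n + 1) := by positivity
    linarith

lemma hasSum_e (h0 : 0 < p) (h1 : p < 1) :
    HasSum (eterm p) (1 / qPochInf (p ^ 2) (p ^ 2)) := by
  refine hasSum_of_exhaust _ (eterm_nonneg h0) (fun n => eset n n) ?_ ?_ _ ?_
  · intro a b hab x hx
    simp only [mem_eset] at hx ⊢
    refine ⟨fun i hi => ?_, fun i hi => hx.2 i (by omega)⟩
    by_cases hia : i < a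
    · exact (hx.1 i hia).trans hab
    · rw [hx.2 i (by omega)]; omega
  · intro x hx
    unfold eterm at hx
    split_ifs at hx with hc
    · obtain ⟨N, hN⟩ := hc
      refine ⟨N + ∑ i ∈ range N, x i, (mem_eset _ _ _).2 ⟨fun i hi => ?_, fun i hi => hN i (by omega)⟩⟩
      by_cases hiN : i < N
      · have := Finset.single_le_sum (f := x) (fun i _ => Nat.zero_le _) (Finset.mem_range.2 hiN)
        omega
      · rw [hN i (by omega)]; omega
    · exact absurd rfl hx
  · refine (eprod_tendsto h0 h1).congr fun n => ?_
    rw [← sum_eset]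
    refine Finset.sum_congr rfl fun e he => ?_
    rw [mem_eset] at he
    unfold eterm
    rw [if_pos ⟨n, he.2⟩, ewt, finsum_range _ n fun i hi => by rw [he.2 i hi, mul_zero]]

lemma hasSum_prod_terms (h0 : 0 < p) (h1 : p < 1) (y B : ℤ) (c : ℝ) (h : HasSum (pterm p y B) c) :
    HasSum (fun z : (ℕ → ℤ) × (ℕ → ℕ) => pterm p y B z.1 * eterm p z.2)
      (c * (1 / qPochInf (p ^ 2) (p ^ 2))) := by
  have he := hasSum_e h0 h1
  exact h.mul he (h.summable.mul_of_nonneg he.summable (pterm_nonneg h0 y B) (eterm_nonneg h0))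

/-! ### The bijection -/

structure RowData (y : ℤ) (R : ℕ → ℕ → Prop) (D : ℕ → ℕ → ℤ) : Prop where
  r0 : R 0 0
  d0 : D 0 0 = y
  bd : ∀ a b, R a b → -1 ≤ D a b ∧ D a b ≤ 1
  step : ∀ a b a' b', R a b → R a' b' → a' ≤ a → b' ≤ b →
    ∃ k : ℕ, a + b = a' + b' + (2 * k + (D a b - D a' b').natAbs)
  inj : ∀ a b a' b', R a b → R a' b' → a + b = a' + b' → D a b = D a' b' → a = a' ∧ b = b'
  ex : ∀ (n : ℕ) (d : ℤ), -1 ≤ d → d ≤ 1 → (∃ k : ℕ, n = 2 * k + (d - y).natAbs) →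
    ∃ a b, R a b ∧ a + b = n ∧ D a b = d
  mono : ∀ a b a' b', R a b → R a' b' → a' + b' + (D a b - D a' b').natAbs ≤ a + b →
    a' ≤ a ∧ b' ≤ b

lemma rowData1 : RowData (-1) (fun a b => b + 1 ≤ a + 1 ∧ a + 1 ≤ b + 3)
    (fun a b => ((a % 2 + b % 2 : ℕ) : ℤ) - 1) where
  r0 := by omega
  d0 := by norm_num
  bd := by intro a b h; omega
  step := by
    intro a b a' b' h h' ha hb
    refine ⟨(a + b - (a' + b') - (((a % 2 + b % 2 : ℕ) : ℤ) - 1 -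
      (((a' % 2 + b' % 2 : ℕ) : ℤ) - 1)).natAbs) / 2, ?_⟩
    omega
  inj := by intro a b a' b' h h' hs hd; omega
  ex := by
    rintro n d h1 h2 ⟨k, hk⟩
    by_cases h0 : d = 0
    · exact ⟨(n + 1) / 2, (n - 1) / 2, by omega, by omega, by omega⟩
    · by_cases hn : (d = -1 ∧ n % 4 = 0) ∨ (d = 1 ∧ n % 4 = 2)
      · exact ⟨n / 2, n / 2, by omega, by omega, by omega⟩
      · exact ⟨n / 2 + 1, n / 2 - 1, by omega, by omega, by omega⟩
  mono := by intro a b a' b' h h' hs; omega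

lemma rowData3 : RowData 0 (fun a b => b + 1 ≤ a + 2 ∧ a + 1 ≤ b + 2)
    (fun a b => ((a % 2 : ℕ) : ℤ) - ((b % 2 : ℕ) : ℤ)) where
  r0 := by omega
  d0 := by norm_num
  bd := by intro a b h; omega
  step := by
    intro a b a' b' h h' ha hb
    refine ⟨(a + b - (a' + b') - (((a % 2 : ℕ) : ℤ) - ((b % 2 : ℕ) : ℤ) -
      (((a' % 2 : ℕ) : ℤ) - ((b' % 2 : ℕ) : ℤ))).natAbs) / 2, ?_⟩
    omega
  inj := by intro a b a' b' h h' hs hd; omega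
  ex := by
    rintro n d h1 h2 ⟨k, hk⟩
    by_cases h0 : d = 0
    · exact ⟨n / 2, n / 2, by omega, by omega, by omega⟩
    · by_cases hn : (d = 1 ∧ n % 4 = 1) ∨ (d = -1 ∧ n % 4 = 3)
      · exact ⟨(n + 1) / 2, (n - 1) / 2, by omega, by omega, by omega⟩
      · exact ⟨(n - 1) / 2, (n + 1) / 2, by omega, by omega, by omega⟩
  mono := by intro a b a' b' h h' hs; omega

lemma yd_bound {f : ℕ → ℕ} (hf : IsYD f) : ∃ N, ∀ i, N ≤ i → f i = 0 := by
  obtain ⟨ha, N, hN⟩ := hf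
  exact ⟨N, fun i hi => Nat.le_zero.1 (hN ▸ ha hi)⟩

lemma size_eq {f : ℕ → ℕ} {N : ℕ} (h : ∀ i, N ≤ i → f i = 0) : sizeYD f = ∑ i ∈ range N, f i :=
  finsum_range _ N h

lemma abel_sum (n m : ℕ → ℕ) (h : ∀ i, n i = n (i + 1) + m i) (N : ℕ) :
    ∑ i ∈ range N, n i = ∑ i ∈ range N, (i + 1) * m i + N * n N := by
  induction N with
  | zero => simp
  | succ N ih =>
    rw [sum_range_succ, sum_range_succ, ih, h N]
    ring

def px (D : ℕ → ℕ → ℤ) (f g : ℕ → ℕ) (i : ℕ) : ℤ := D (f i) (g i)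
def pe (D : ℕ → ℕ → ℤ) (f g : ℕ → ℕ) (i : ℕ) : ℕ :=
  (f i + g i - (f (i + 1) + g (i + 1)) - (px D f g i - px D f g (i + 1)).natAbs) / 2

section
variable {y : ℤ} {R : ℕ → ℕ → Prop} {D : ℕ → ℕ → ℤ}

lemma psi_step (H : RowData y R D) {f g : ℕ → ℕ} (hf : Antitone f) (hg : Antitone g)
    (hR : ∀ i, R (f i) (g i)) (i : ℕ) :
    f i + g i = f (i + 1) + g (i + 1) + (2 * pe D f g i + (px D f g i - px D f g (i + 1)).natAbs) := by
  obtain ⟨k, hk⟩ := H.step _ _ _ _ (hR i) (hR (i + 1)) (hf (Nat.le_succ i)) (hg (Nat.le_succ i))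
  change _ = _ + (2 * k + (px D f g i - px D f g (i + 1)).natAbs) at hk
  unfold pe
  omega

lemma psi_val (H : RowData y R D) {f g : ℕ → ℕ} (hf : IsYD f) (hg : IsYD g)
    (hR : ∀ i, R (f i) (g i)) (B : ℤ) (hB : stat y (px D f g) = B) :
    pterm p y B (px D f g) * eterm p (pe D f g) = p ^ (sizeYD f + sizeYD g) := by
  obtain ⟨N1, hN1⟩ := yd_bound hf
  obtain ⟨N2, hN2⟩ := yd_bound hg
  have h1 : ∀ i, N1 + N2 ≤ i → f i = 0 := fun i hi => hN1 i (by omega)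
  have h2 : ∀ i, N1 + N2 ≤ i → g i = 0 := fun i hi => hN2 i (by omega)
  have hx : ∀ i, N1 + N2 ≤ i → px D f g i = y := fun i hi => by
    rw [px, h1 i hi, h2 i hi, H.d0]
  have he : ∀ i, N1 + N2 ≤ i → pe D f g i = 0 := fun i hi => by
    rw [pe, h1 i hi, h2 i hi]; simp
  have hpath : IsPath y (px D f g) := ⟨fun i => H.bd _ _ (hR i), _, hx⟩
  rw [pterm, eterm, if_pos ⟨hpath, hB⟩, if_pos ⟨_, he⟩, ← pow_add]
  congr 1
  rw [wt_eq hx, ewt, finsum_range _ (N1 + N2) fun i hi => by rw [he i hi, mul_zero],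
    size_eq h1, size_eq h2, ← Finset.sum_add_distrib,
    abel_sum (fun i => f i + g i) _ (psi_step H hf.1 hg.1 hR), h1 _ le_rfl, h2 _ le_rfl,
    Finset.mul_sum, add_zero, mul_zero, add_zero, ← Finset.sum_add_distrib]
  refine Finset.sum_congr rfl fun i _ => ?_
  ring

lemma psi_inj (H : RowData y R D) {f g f' g' : ℕ → ℕ} (hf : IsYD f) (hg : IsYD g)
    (hR : ∀ i, R (f i) (g i)) (hf' : IsYD f') (hg' : IsYD g') (hR' : ∀ i, R (f' i) (g' i))
    (hx : px D f g = px D f' g') (he : pe D f g = pe D f' g') : f = f' ∧ g = g' := by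
  obtain ⟨N1, hN1⟩ := yd_bound hf
  obtain ⟨N2, hN2⟩ := yd_bound hg
  obtain ⟨N3, hN3⟩ := yd_bound hf'
  obtain ⟨N4, hN4⟩ := yd_bound hg'
  have key : ∀ k i, N1 + N2 + N3 + N4 ≤ i + k → f i + g i = f' i + g' i := by
    intro k
    induction k with
    | zero =>
      intro i hi
      rw [hN1 i (by omega), hN2 i (by omega), hN3 i (by omega), hN4 i (by omega)]
    | succ k ih =>
      intro i hi
      have e1 := psi_step H hf.1 hg.1 hR i
      have e2 := psi_step H hf'.1 hg'.1 hR' i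
      rw [hx, he] at e1
      have := ih (i + 1) (by omega)
      omega
  have key2 : ∀ i, f i = f' i ∧ g i = g' i := fun i =>
    H.inj _ _ _ _ (hR i) (hR' i) (key (N1 + N2 + N3 + N4) i (by omega)) (congrFun hx i)
  exact ⟨funext fun i => (key2 i).1, funext fun i => (key2 i).2⟩

lemma psi_surj (H : RowData y R D) {x : ℕ → ℤ} {e : ℕ → ℕ} (hx : IsPath y x)
    (he : ∃ N, ∀ i, N ≤ i → e i = 0) : ∃ f g : ℕ → ℕ, IsYD f ∧ IsYD g ∧ (∀ i, R (f i) (g i)) ∧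
      px D f g = x ∧ pe D f g = e := by
  obtain ⟨hb, N1, hN1⟩ := hx
  obtain ⟨N2, hN2⟩ := he
  set m : ℕ → ℕ := fun j => 2 * e j + (x j - x (j + 1)).natAbs with hm
  set N := N1 + N2 with hN
  obtain ⟨n, hn0, hn⟩ : ∃ n : ℕ → ℕ, (∀ i, N ≤ i → n i = 0) ∧ ∀ i, n i = n (i + 1) + m i := by
    refine ⟨fun i => ∑ j ∈ Finset.Ico i N, m j, fun i hi => ?_, fun i => ?_⟩
    · dsimp only
      rw [Finset.Ico_eq_empty_of_le hi, Finset.sum_empty]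
    · dsimp only
      by_cases hi : i < N
      · rw [Finset.sum_eq_sum_Ico_succ_bot hi, add_comm]
      · rw [Finset.Ico_eq_empty_of_le (by omega), Finset.Ico_eq_empty_of_le (by omega)]
        simp only [hm, hN2 i (by omega), hN1 i (by omega), hN1 (i + 1) (by omega)]
        simp
  have par : ∀ k i, N ≤ i + k → ∃ t : ℕ, n i = 2 * t + (x i - y).natAbs := by
    intro k
    induction k with
    | zero =>
      intro i hi
      exact ⟨0, by rw [hn0 i (by omega), hN1 i (by omega)]; simp⟩
    | succ k ih =>
      intro i hi
      obtain ⟨t, ht⟩ := ih (i + 1) (by omega)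
      have h := hn i
      simp only [hm] at h
      exact ⟨(n i - (x i - y).natAbs) / 2, by omega⟩
  choose f g hR hs hD using fun i => H.ex (n i) (x i) (hb i).1 (hb i).2 (par N i (by omega))
  have hmono : ∀ i, f (i + 1) ≤ f i ∧ g (i + 1) ≤ g i := by
    intro i
    refine H.mono _ _ _ _ (hR i) (hR (i + 1)) ?_
    rw [hs, hs, hD, hD, hn i]
    simp only [hm]
    omega
  have hxx : px D f g = x := funext hD
  refine ⟨f, g, ⟨antitone_nat_of_succ_le fun i => (hmono i).1, N, ?_⟩,
    ⟨antitone_nat_of_succ_le fun i => (hmono i).2, N, ?_⟩, hR, hxx, ?_⟩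
  · have := hs N; have := hn0 N le_rfl; omega
  · have := hs N; have := hn0 N le_rfl; omega
  · funext i
    have h := hn i
    simp only [hm] at h
    rw [pe, hxx, hs, hs]
    omega

lemma gf_eq (H : RowData y R D) (σ1 σ2 s0 s1 : ℕ) (ℓ B : ℤ)
    (hR : ∀ a b, R a b ↔ b + 1 ≤ a + s1 ∧ a + 1 ≤ b + s0)
    (hcol : ∀ f g, IsYD f → IsYD g →
      (((colCount 2 σ1 f 1 + colCount 2 σ2 g 1 : ℤ)
        - (colCount 2 σ1 f 0 + colCount 2 σ2 g 0 : ℤ)) = ℓ ↔ stat y (px D f g) = B))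
    (c q : ℝ) (hq : ∀ r : ℕ, q ^ ((r : ℝ) / 2) = p ^ r)
    (hc : HasSum (fun z : (ℕ → ℤ) × (ℕ → ℕ) => pterm p y B z.1 * eterm p z.2) c) :
    burgePairGF σ1 σ2 s0 s1 ℓ q = c := by
  unfold burgePairGF
  set T := {Y : (ℕ → ℕ) × (ℕ → ℕ) // IsYD Y.1 ∧ IsYD Y.2 ∧
      (∀ i, Y.2 i + 1 ≤ Y.1 i + s1) ∧ (∀ i, Y.1 i + 1 ≤ Y.2 i + s0) ∧
      ((colCount 2 σ1 Y.1 1 + colCount 2 σ2 Y.2 1 : ℤ)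
        - (colCount 2 σ1 Y.1 0 + colCount 2 σ2 Y.2 0 : ℤ)) = ℓ} with hT
  have hRT : ∀ Y : T, ∀ i, R (Y.1.1 i) (Y.1.2 i) := fun Y i =>
    (hR _ _).2 ⟨Y.2.2.2.1 i, Y.2.2.2.2.1 i⟩
  let ψ : T → (ℕ → ℤ) × (ℕ → ℕ) := fun Y => (px D Y.1.1 Y.1.2, pe D Y.1.1 Y.1.2)
  have hinj : Function.Injective ψ := by
    intro Y Y' h
    have h1 : px D Y.1.1 Y.1.2 = px D Y'.1.1 Y'.1.2 := congrArg Prod.fst h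
    have h2 : pe D Y.1.1 Y.1.2 = pe D Y'.1.1 Y'.1.2 := congrArg Prod.snd h
    obtain ⟨h3, h4⟩ := psi_inj H Y.2.1 Y.2.2.1 (hRT Y) Y'.2.1 Y'.2.2.1 (hRT Y') h1 h2
    exact Subtype.ext (Prod.ext h3 h4)
  rw [← hc.tsum_eq, ← hinj.tsum_eq]
  · refine tsum_congr fun Y => ?_
    rw [hq]
    exact (psi_val H Y.2.1 Y.2.2.1 (hRT Y) B ((hcol _ _ Y.2.1 Y.2.2.1).1 Y.2.2.2.2.2)).symm
  · rintro ⟨x, e⟩ hz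
    rw [Function.mem_support] at hz
    have hz1 : pterm p y B x ≠ 0 := left_ne_zero_of_mul hz
    have hz2 : eterm p e ≠ 0 := right_ne_zero_of_mul hz
    unfold pterm at hz1
    unfold eterm at hz2
    split_ifs at hz1 with hx
    · split_ifs at hz2 with he
      · obtain ⟨f, g, hf, hg, hRR, hpx, hpe⟩ := psi_surj H hx.1 he
        refine ⟨⟨(f, g), hf, hg, fun i => ((hR _ _).1 (hRR i)).1, fun i => ((hR _ _).1 (hRR i)).2,
          (hcol f g hf hg).2 (by rw [hpx]; exact hx.2)⟩, ?_⟩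
        exact Prod.ext hpx hpe
      · exact absurd rfl hz2
    · exact absurd rfl hz1

end

/-! ### Colour counting -/

lemma neg_one_pow_val (k : ℕ) : (-1 : ℤ) ^ k = if k % 2 = 0 then 1 else -1 := by
  split_ifs with h
  · exact Even.neg_one_pow (Nat.even_iff.2 h)
  · exact Odd.neg_one_pow (Nat.odd_iff.2 (by omega))

lemma row_count (σ i k M : ℕ) :
    ∑ j ∈ range M, (((if j < k ∧ ((σ : ℤ) + j - i) % 2 = 1 then 1 else 0 : ℕ) : ℤ) -
      ((if j < k ∧ ((σ : ℤ) + j - i) % 2 = 0 then 1 else 0 : ℕ) : ℤ)) =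
      (-1) ^ (i + σ + 1) * ((min M k % 2 : ℕ) : ℤ) := by
  rw [neg_one_pow_val]
  induction M with
  | zero => simp
  | succ M ih =>
    rw [sum_range_succ, ih]
    rcases Nat.lt_or_ge M k with hk | hk
    · rw [min_eq_left hk.le, min_eq_left (by omega : M + 1 ≤ k)]
      split_ifs <;> push_cast <;> omega
    · rw [min_eq_right hk, min_eq_right (by omega : k ≤ M + 1)]
      simp [show ¬ M < k by omega]

lemma colCount_eq (σ c N : ℕ) {f : ℕ → ℕ} (hf : Antitone f) (h : ∀ i, N ≤ i → f i = 0) :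
    colCount 2 σ f c = ∑ i ∈ range N, ∑ j ∈ range (f 0),
      if j < f i ∧ ((σ : ℤ) + j - i) % 2 = c then 1 else 0 := by
  rw [← Finset.sum_product', ← Finset.card_filter, ← Set.ncard_coe_finset]
  unfold colCount
  congr 1
  ext ⟨i, j⟩
  simp only [Set.mem_setOf_eq, Finset.coe_filter, Finset.mem_product, Finset.mem_range]
  constructor
  · rintro ⟨h1, h2⟩
    refine ⟨⟨?_, h1.trans_le (hf (Nat.zero_le i))⟩, h1, h2⟩
    by_contra hc
    rw [h i (by omega)] at h1
    omega
  · rintro ⟨-, h1, h2⟩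
    exact ⟨h1, h2⟩

lemma col_diff (σ N : ℕ) {f : ℕ → ℕ} (hf : Antitone f) (h : ∀ i, N ≤ i → f i = 0) :
    (colCount 2 σ f 1 : ℤ) - colCount 2 σ f 0 =
      ∑ i ∈ range N, (-1) ^ (i + σ + 1) * ((f i % 2 : ℕ) : ℤ) := by
  rw [colCount_eq σ 1 N hf h, colCount_eq σ 0 N hf h, Nat.cast_sum, Nat.cast_sum,
    ← Finset.sum_sub_distrib]
  refine Finset.sum_congr rfl fun i _ => ?_
  rw [Nat.cast_sum, Nat.cast_sum, ← Finset.sum_sub_distrib]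
  have := row_count σ i (f i) (f 0)
  rw [min_eq_right (hf (Nat.zero_le i))] at this
  rw [← this]
  simp only [Nat.cast_one, Nat.cast_zero]

lemma col1 (ℓ B : ℤ) (hB : B = -ℓ) (f g : ℕ → ℕ) (hf : IsYD f) (hg : IsYD g) :
    (((colCount 2 0 f 1 + colCount 2 0 g 1 : ℤ)
        - (colCount 2 0 f 0 + colCount 2 0 g 0 : ℤ)) = ℓ ↔
      stat (-1) (px (fun a b => ((a % 2 + b % 2 : ℕ) : ℤ) - 1) f g) = B) := by
  obtain ⟨N1, hN1⟩ := yd_bound hf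
  obtain ⟨N2, hN2⟩ := yd_bound hg
  have h1 : ∀ i, N1 + N2 ≤ i → f i = 0 := fun i hi => hN1 i (by omega)
  have h2 : ∀ i, N1 + N2 ≤ i → g i = 0 := fun i hi => hN2 i (by omega)
  have e1 := col_diff 0 _ hf.1 h1
  have e2 := col_diff 0 _ hg.1 h2
  have e3 : stat (-1) (px (fun a b => ((a % 2 + b % 2 : ℕ) : ℤ) - 1) f g) =
      -(∑ i ∈ range (N1 + N2), (-1) ^ (i + 0 + 1) * ((f i % 2 : ℕ) : ℤ)) -
      ∑ i ∈ range (N1 + N2), (-1) ^ (i + 0 + 1) * ((g i % 2 : ℕ) : ℤ) := by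
    rw [stat_eq (N := N1 + N2) (fun i hi => by simp [px, h1 i hi, h2 i hi]),
      ← Finset.sum_neg_distrib, ← Finset.sum_sub_distrib]
    refine Finset.sum_congr rfl fun i _ => ?_
    simp only [px, Nat.cast_add]
    ring
  rw [e3, hB]
  constructor <;> intro h <;> linarith

lemma col3 (f g : ℕ → ℕ) (hf : IsYD f) (hg : IsYD g) :
    (((colCount 2 1 f 1 + colCount 2 0 g 1 : ℤ)
        - (colCount 2 1 f 0 + colCount 2 0 g 0 : ℤ)) = 0 ↔
      stat 0 (px (fun a b => ((a % 2 : ℕ) : ℤ) - ((b % 2 : ℕ) : ℤ)) f g) = 0) := by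
  obtain ⟨N1, hN1⟩ := yd_bound hf
  obtain ⟨N2, hN2⟩ := yd_bound hg
  have h1 : ∀ i, N1 + N2 ≤ i → f i = 0 := fun i hi => hN1 i (by omega)
  have h2 : ∀ i, N1 + N2 ≤ i → g i = 0 := fun i hi => hN2 i (by omega)
  have e1 := col_diff 1 _ hf.1 h1
  have e2 := col_diff 0 _ hg.1 h2
  have e3 : stat 0 (px (fun a b => ((a % 2 : ℕ) : ℤ) - ((b % 2 : ℕ) : ℤ)) f g) =
      (∑ i ∈ range (N1 + N2), (-1) ^ (i + 1 + 1) * ((f i % 2 : ℕ) : ℤ)) +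
      ∑ i ∈ range (N1 + N2), (-1) ^ (i + 0 + 1) * ((g i % 2 : ℕ) : ℤ) := by
    rw [stat_eq (N := N1 + N2) (fun i hi => by simp [px, h1 i hi, h2 i hi]),
      ← Finset.sum_add_distrib]
    refine Finset.sum_congr rfl fun i _ => ?_
    simp only [px]
    ring
  rw [e3]
  constructor <;> intro h <;> linarith

/-! ### Conclusion -/

lemma conclusion (h0 : 0 < p) (h1 : p < 1) (q : ℝ) (hqp : q = p ^ 2)
    (hq : ∀ r : ℕ, q ^ ((r : ℝ) / 2) = p ^ r) :
    X2020 q + X2002 q = qPochInf (-p) q / qPochInf q q ∧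
    X2020 q - X2002 q = qPochInf p p / (qPochInf q q) ^ 2 ∧
    X1111 q = qPochInf (q ^ 2) (q ^ 2) / (qPochInf q q) ^ 2 := by
  have hQ := Q_pos h0 h1
  have s1 := hasSum_prod_terms h0 h1 _ _ _
    (hasSum_path h0 (-1) 0 (by norm_num) _ (Gam_lim_0 h0 h1))
  have s2 := hasSum_prod_terms h0 h1 _ _ _
    (hasSum_path h0 (-1) 1 (by norm_num) _ (Gam_lim_1 h0 h1))
  have s3 := hasSum_prod_terms h0 h1 _ _ _
    (hasSum_path h0 0 0 (by norm_num) _ (Gam_lim_c h0 h1))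
  have g1 := gf_eq rowData1 0 0 3 1 0 0 (fun _ _ => Iff.rfl) (col1 0 0 (by norm_num)) _ q hq s1
  have g2 := gf_eq rowData1 0 0 3 1 (-1) 1 (fun _ _ => Iff.rfl) (col1 (-1) 1 (by norm_num)) _ q hq s2
  have g3 := gf_eq rowData3 1 0 2 2 0 0 (fun _ _ => Iff.rfl) col3 _ q hq s3
  obtain ⟨b1, b2⟩ := bb_sums h0 h1
  have cs := cc_sums h0 h1
  have ps := poch_split h0 h1
  have pd := poch_double (p ^ 2) (by positivity) (sq_lt h0 h1)
  unfold X2020 X2002 X1111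
  rw [g1, g2, g3, hqp]
  refine ⟨?_, ?_, ?_⟩
  · rw [← b1]; field_simp
  · rw [ps, ← b2]; field_simp
  · rw [← cs] at pd
    rw [eq_div_iff (by positivity)]
    have hQ' := hQ.ne'
    generalize qPochInf ((p ^ 2) ^ 2) ((p ^ 2) ^ 2) = W at *
    field_simp
    linarith

end SL2

/-- Level-2 string functions of affine `sl(2)`:
`X^{[2,0]}_{[2,0]} + X^{[2,0]}_{[0,2]} = (−q^{1/2}; q)_∞/(q; q)_∞`,
`X^{[2,0]}_{[2,0]} − X^{[2,0]}_{[0,2]} = (q^{1/2}; q^{1/2})_∞/(q; q)_∞²`, and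
`X^{[1,1]}_{[1,1]} = (q²; q²)_∞/(q; q)_∞²`. -/
theorem sl2_level2_string_functions (q : ℝ) (h0 : 0 < q) (h1 : q < 1) :
    X2020 q + X2002 q = qPochInf (-(q ^ ((1 : ℝ) / 2))) q / qPochInf q q ∧
    X2020 q - X2002 q =
      qPochInf (q ^ ((1 : ℝ) / 2)) (q ^ ((1 : ℝ) / 2)) / (qPochInf q q) ^ 2 ∧
    X1111 q = qPochInf (q ^ 2) (q ^ 2) / (qPochInf q q) ^ 2 := by
  have hs : (q ^ ((1 : ℝ) / 2)) ^ 2 = q := by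
    rw [← Real.rpow_natCast, ← Real.rpow_mul h0.le]; norm_num
  refine SL2.conclusion (p := q ^ ((1 : ℝ) / 2)) (Real.rpow_pos_of_pos h0 _)
    (Real.rpow_lt_one h0.le h1 (by norm_num)) q hs.symm fun r => ?_
  rw [← Real.rpow_natCast, ← Real.rpow_mul h0.le]
  congr 1
  ring
end
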